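/- arXiv:2601.21366 — 4 statements merged into one kernel-verified Lean document; each statement's English description precedes it below -/
import Mathlib

section
/- Let d ≥ 2 and let B be a symmetric invertible d×d real matrix. If two Borel probability measures μ₁, μ₂ on the unit sphere S^{d-1} ⊂ ℝ^d satisfy ∫ exp(xᵀ B y) dμ₁(y) = ∫ exp(xᵀ B y) dμ₂(y) for every x ∈ S^{d-1}, then μ₁ = μ₂. -/
open MeasureTheory Real

open Filter ProbabilityTheory
open scoped Topology RealInnerProductSpace

section ExpTransform

variable {E : Type*} [NormedAddCommGroup E] [InnerProductSpace ℝ E]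

lemma exp_inner_le_exp_norm {x y : E} (hy : ‖y‖ = 1) : Real.exp ⟪x, y⟫ ≤ Real.exp ‖x‖ := by
  gcongr
  simpa [hy] using real_inner_le_norm x y

lemma abs_exp_add_exp_neg_sub_two_sub_sq_le {u : ℝ} (hu : |u| ≤ 1) :
    |Real.exp u + Real.exp (-u) - 2 - u ^ 2| ≤ |u| ^ 3 := by
  have h₁ := Real.exp_bound hu (n := 3) (by norm_num)
  have h₂ := Real.exp_bound (x := -u) (by rwa [abs_neg]) (n := 3) (by norm_num)
  rw [abs_neg] at h₂
  have h₀ : 0 ≤ |u| ^ 3 := by positivity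
  norm_num [Finset.sum_range_succ, Nat.factorial, abs_le] at h₁ h₂
  rw [abs_le]
  constructor <;> linarith [h₁.1, h₁.2, h₂.1, h₂.2]

variable [MeasurableSpace E] {μ ν : Measure E}

/-- The exponential (Laplace) transform `x ↦ ∫ exp ⟪x, y⟫ dμ(y)` of a measure on an inner product
space. -/
noncomputable def expTransform (μ : Measure E) (x : E) : ℝ :=
  ∫ y, Real.exp ⟪x, y⟫ ∂μ

variable [BorelSpace E] [FiniteDimensional ℝ E]

lemma integrable_exp_inner [IsFiniteMeasure μ] (hμ : ∀ᵐ y ∂μ, ‖y‖ = 1) (x : E) :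
    Integrable (fun y ↦ Real.exp ⟪x, y⟫) μ := by
  refine Integrable.of_bound (by fun_prop) (Real.exp ‖x‖) ?_
  filter_upwards [hμ] with y hy
  rw [Real.norm_eq_abs, Real.abs_exp]
  exact exp_inner_le_exp_norm hy

lemma continuous_expTransform [IsFiniteMeasure μ] (hμ : ∀ᵐ y ∂μ, ‖y‖ = 1) :
    Continuous (expTransform μ) := by
  rw [continuous_iff_continuousAt]
  intro x₀
  refine continuousAt_of_dominated (bound := fun _ ↦ Real.exp (‖x₀‖ + 1))
    (.of_forall fun x ↦ by fun_prop) ?_ (integrable_const _) (.of_forall fun y ↦ by fun_prop)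
  filter_upwards [continuous_norm.continuousAt.eventually_lt_const (lt_add_one ‖x₀‖)] with x hx
  filter_upwards [hμ] with y hy
  rw [Real.norm_eq_abs, Real.abs_exp]
  exact (exp_inner_le_exp_norm hy).trans (by gcongr)

/-- The discrete Laplacian of the exponential transform of a measure on the unit sphere
approximates the transform itself. -/
lemma abs_sum_second_difference_expTransform_le [IsFiniteMeasure μ] (hμ : ∀ᵐ y ∂μ, ‖y‖ = 1)
    {ι : Type*} [Fintype ι] (b : OrthonormalBasis ι ℝ E) (x : E) {s : ℝ} (hs₀ : 0 ≤ s)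
    (hs₁ : s ≤ 1) :
    |∑ i, (expTransform μ (x + s • b i) + expTransform μ (x - s • b i) - 2 * expTransform μ x)
        - s ^ 2 * expTransform μ x| ≤ Fintype.card ι * s ^ 3 * expTransform μ x := by
  have hint := integrable_exp_inner hμ
  have hterm (i : ι) : Integrable (fun y ↦ Real.exp ⟪x + s • b i, y⟫ + Real.exp ⟪x - s • b i, y⟫
      - 2 * Real.exp ⟪x, y⟫) μ := ((hint _).add (hint _)).sub ((hint _).const_mul _)
  have heq : ∑ i, (expTransform μ (x + s • b i) + expTransform μ (x - s • b i)
      - 2 * expTransform μ x) - s ^ 2 * expTransform μ x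
      = ∫ y, (∑ i, (Real.exp ⟪x + s • b i, y⟫ + Real.exp ⟪x - s • b i, y⟫
        - 2 * Real.exp ⟪x, y⟫) - s ^ 2 * Real.exp ⟪x, y⟫) ∂μ := by
    rw [integral_sub (integrable_finsetSum _ fun i _ ↦ hterm i) ((hint _).const_mul _),
      integral_finsetSum _ fun i _ ↦ hterm i, integral_const_mul]
    congr 1
    refine Finset.sum_congr rfl fun i _ ↦ ?_
    have hadd : Integrable (fun y ↦ Real.exp ⟪x + s • b i, y⟫ + Real.exp ⟪x - s • b i, y⟫) μ :=
      (hint _).add (hint _)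
    rw [integral_sub hadd ((hint _).const_mul _), integral_add (hint _) (hint _),
      integral_const_mul]
    rfl
  rw [heq, expTransform, ← integral_const_mul, ← Real.norm_eq_abs]
  refine norm_integral_le_of_norm_le ((hint x).const_mul _) ?_
  filter_upwards [hμ] with y hy
  have hfactor : ∑ i, (Real.exp ⟪x + s • b i, y⟫ + Real.exp ⟪x - s • b i, y⟫
      - 2 * Real.exp ⟪x, y⟫) - s ^ 2 * Real.exp ⟪x, y⟫
      = (∑ i, (Real.exp (s * ⟪b i, y⟫) + Real.exp (-(s * ⟪b i, y⟫)) - 2 - (s * ⟪b i, y⟫) ^ 2))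
        * Real.exp ⟪x, y⟫ := by
    have hsq : ∑ i, (s * ⟪b i, y⟫) ^ 2 = s ^ 2 := by
      simp_rw [mul_pow, ← Finset.mul_sum, b.sum_sq_inner_right, hy]
      ring
    rw [Finset.sum_sub_distrib _ (fun i ↦ (s * ⟪b i, y⟫) ^ 2), hsq, sub_mul, Finset.sum_mul]
    congr 1
    refine Finset.sum_congr rfl fun i _ ↦ ?_
    rw [inner_add_left, inner_sub_left, real_inner_smul_left, Real.exp_add, sub_eq_add_neg ⟪x, y⟫,
      Real.exp_add]
    ring
  rw [hfactor, norm_mul, Real.norm_eq_abs, Real.norm_eq_abs, Real.abs_exp]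
  gcongr
  calc _ ≤ ∑ i, |Real.exp (s * ⟪b i, y⟫) + Real.exp (-(s * ⟪b i, y⟫)) - 2
          - (s * ⟪b i, y⟫) ^ 2| := Finset.abs_sum_le_sum_abs _ _
    _ ≤ ∑ _i : ι, s ^ 3 := by
      refine Finset.sum_le_sum fun i _ ↦ ?_
      have hu : |s * ⟪b i, y⟫| ≤ s := by
        rw [abs_mul, abs_of_nonneg hs₀]
        refine mul_le_of_le_one_right hs₀ ?_
        simpa [hy] using abs_real_inner_le_norm (b i) y
      exact (abs_exp_add_exp_neg_sub_two_sub_sq_le (hu.trans hs₁)).trans (by gcongr)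
    _ = Fintype.card ι * s ^ 3 := by simp

/-- At an interior local maximum, the difference of the exponential transforms of two measures on
the unit sphere is nonpositive. -/
lemma expTransform_le_of_isLocalMax [IsFiniteMeasure μ] [IsFiniteMeasure ν]
    (hμ : ∀ᵐ y ∂μ, ‖y‖ = 1) (hν : ∀ᵐ y ∂ν, ‖y‖ = 1) {x : E}
    (hx : IsLocalMax (fun z ↦ expTransform μ z - expTransform ν z) x) :
    expTransform μ x ≤ expTransform ν x := by
  let b := stdOrthonormalBasis ℝ E
  set c : ℝ := Fintype.card (Fin (Module.finrank ℝ E)) * (expTransform μ x + expTransform ν x)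
    with hc
  have hlim : Tendsto (fun s : ℝ ↦ c * s) (𝓝[>] 0) (𝓝 0) := by
    have : Tendsto (fun s : ℝ ↦ c * s) (𝓝 0) (𝓝 (c * 0)) := by
      apply Continuous.tendsto
      fun_prop
    rw [mul_zero] at this
    exact this.mono_left nhdsWithin_le_nhds
  rw [← sub_nonpos]
  refine ge_of_tendsto hlim ?_
  have hadd (i) : ∀ᶠ s in 𝓝[>] (0 : ℝ),
      expTransform μ (x + s • b i) - expTransform ν (x + s • b i)
        ≤ expTransform μ x - expTransform ν x := by
    have : Tendsto (fun s : ℝ ↦ x + s • b i) (𝓝 0) (𝓝 x) := by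
      simpa using (show Continuous fun s : ℝ ↦ x + s • b i by fun_prop).tendsto 0
    exact (this.mono_left nhdsWithin_le_nhds).eventually hx
  have hsub (i) : ∀ᶠ s in 𝓝[>] (0 : ℝ),
      expTransform μ (x - s • b i) - expTransform ν (x - s • b i)
        ≤ expTransform μ x - expTransform ν x := by
    have : Tendsto (fun s : ℝ ↦ x - s • b i) (𝓝 0) (𝓝 x) := by
      simpa using (show Continuous fun s : ℝ ↦ x - s • b i by fun_prop).tendsto 0
    exact (this.mono_left nhdsWithin_le_nhds).eventually hx
  filter_upwards [eventually_all.2 hadd, eventually_all.2 hsub,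
    Ioc_mem_nhdsGT (zero_lt_one' ℝ)] with s hsadd hssub ⟨hs₀, hs₁⟩
  have hμs := (abs_le.1 (abs_sum_second_difference_expTransform_le hμ b x hs₀.le hs₁)).1
  have hνs := (abs_le.1 (abs_sum_second_difference_expTransform_le hν b x hs₀.le hs₁)).2
  have hsum : ∑ i, (expTransform μ (x + s • b i) + expTransform μ (x - s • b i)
      - 2 * expTransform μ x) ≤ ∑ i, (expTransform ν (x + s • b i) + expTransform ν (x - s • b i)
      - 2 * expTransform ν x) :=
    Finset.sum_le_sum fun i _ ↦ by linarith [hsadd i, hssub i]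
  refine le_of_mul_le_mul_left ?_ (pow_pos hs₀ 2)
  rw [hc]
  linarith

/-- Comparison principle: an inequality between exponential transforms of measures on the unit
sphere propagates from the frontier of a compact set to the whole set. -/
lemma expTransform_le_of_le_on_frontier [IsFiniteMeasure μ] [IsFiniteMeasure ν]
    (hμ : ∀ᵐ y ∂μ, ‖y‖ = 1) (hν : ∀ᵐ y ∂ν, ‖y‖ = 1) {K : Set E} (hK : IsCompact K)
    (h : ∀ x ∈ frontier K, expTransform μ x ≤ expTransform ν x) {x : E} (hx : x ∈ K) :
    expTransform μ x ≤ expTransform ν x := by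
  obtain ⟨z, hzK, hz⟩ := hK.exists_isMaxOn ⟨x, hx⟩
    ((continuous_expTransform hμ).sub (continuous_expTransform hν)).continuousOn
  have hle : expTransform μ z ≤ expTransform ν z := by
    by_cases hzi : z ∈ interior K
    · exact expTransform_le_of_isLocalMax hμ hν (hz.isLocalMax (mem_interior_iff_mem_nhds.1 hzi))
    · exact h z ⟨subset_closure hzK, hzi⟩
  have hxz : expTransform μ x - expTransform ν x ≤ expTransform μ z - expTransform ν z := hz hx
  linarith

/-- A probability measure on the unit sphere is determined by its exponential transform near `0`. -/
lemma ext_of_expTransform_eventuallyEq [IsProbabilityMeasure μ] [IsProbabilityMeasure ν]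
    (hμ : ∀ᵐ y ∂μ, ‖y‖ = 1) (hν : ∀ᵐ y ∂ν, ‖y‖ = 1)
    (h : expTransform μ =ᶠ[𝓝 0] expTransform ν) : μ = ν := by
  refine Measure.ext_of_charFun (funext fun t ↦ ?_)
  have hmgf (ρ : Measure E) (s : ℝ) : mgf (fun y ↦ ⟪t, y⟫) ρ s = expTransform ρ (s • t) := by
    simp [mgf, expTransform, real_inner_smul_left]
  have huniv {ρ : Measure E} [IsFiniteMeasure ρ] (hρ : ∀ᵐ y ∂ρ, ‖y‖ = 1) :
      integrableExpSet (fun y ↦ ⟪t, y⟫) ρ = Set.univ := by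
    refine Set.eq_univ_of_forall fun s ↦ ?_
    simpa [integrableExpSet, real_inner_smul_left] using integrable_exp_inner hρ (s • t)
  have hanalytic {ρ : Measure E} [IsFiniteMeasure ρ] (hρ : ∀ᵐ y ∂ρ, ‖y‖ = 1) :
      AnalyticOnNhd ℝ (mgf (fun y ↦ ⟪t, y⟫) ρ) Set.univ := by
    simpa [huniv hρ] using analyticOnNhd_mgf (X := fun y ↦ ⟪t, y⟫) (μ := ρ)
  have hlim : Tendsto (fun s : ℝ ↦ s • t) (𝓝 0) (𝓝 0) := by
    simpa using (show Continuous fun s : ℝ ↦ s • t by fun_prop).tendsto 0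
  have heq : mgf (fun y ↦ ⟪t, y⟫) μ = mgf (fun y ↦ ⟪t, y⟫) ν := by
    refine (hanalytic hμ).eq_of_eventuallyEq (hanalytic hν) (z₀ := 0) ?_
    filter_upwards [hlim.eventually h] with s hs
    rw [hmgf, hmgf, hs]
  have hI := eqOn_complexMGF_of_mgf heq (x := Complex.I) (by simp [huniv hμ])
  simpa [complexMGF, charFun_apply, real_inner_comm, mul_comm] using hI

/-- A probability measure on the unit sphere is determined by its exponential transform on the
image of the unit sphere under an invertible linear map. -/
lemma ext_of_expTransform_eqOn_image_sphere [IsProbabilityMeasure μ] [IsProbabilityMeasure ν]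
    (hμ : ∀ᵐ y ∂μ, ‖y‖ = 1) (hν : ∀ᵐ y ∂ν, ‖y‖ = 1) (L : E ≃L[ℝ] E)
    (h : ∀ x ∈ Metric.sphere (0 : E) 1, expTransform μ (L x) = expTransform ν (L x)) :
    μ = ν := by
  have hfrontier : ∀ x ∈ frontier (L '' Metric.closedBall 0 1),
      expTransform μ x = expTransform ν x := by
    have himage := L.toHomeomorph.image_frontier (Metric.closedBall 0 1)
    rw [ContinuousLinearEquiv.coe_toHomeomorph] at himage
    rw [← himage, frontier_closedBall _ one_ne_zero]
    rintro _ ⟨x, hx, rfl⟩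
    exact h x hx
  have hK : IsCompact (L '' Metric.closedBall 0 1) :=
    (isCompact_closedBall 0 1).image L.continuous
  have hnhds : L '' Metric.closedBall 0 1 ∈ 𝓝 0 := by
    simpa using L.toHomeomorph.isOpenMap.image_mem_nhds (Metric.closedBall_mem_nhds 0 one_pos)
  refine ext_of_expTransform_eventuallyEq hμ hν ?_
  filter_upwards [hnhds] with x hx
  exact le_antisymm
    (expTransform_le_of_le_on_frontier hμ hν hK (fun z hz ↦ (hfrontier z hz).le) hx)
    (expTransform_le_of_le_on_frontier hν hμ hK (fun z hz ↦ (hfrontier z hz).ge) hx)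

end ExpTransform

/-- **Injectivity for general symmetric invertible bilinear forms** (Remark on general
attention). If `B` is a symmetric invertible `d × d` real matrix and two Borel probability
measures on the unit sphere have equal transforms `x ↦ ∫ exp (xᵀ B y) dμ(y)`, they coincide. -/
theorem attention_transform_injective_of_symm_invertible
    (d : ℕ) (hd : 2 ≤ d) (B : Matrix (Fin d) (Fin d) ℝ)
    (hBsymm : B.IsSymm) (hBinv : IsUnit B.det)
    (μ₁ μ₂ : Measure (EuclideanSpace ℝ (Fin d)))
    [IsProbabilityMeasure μ₁] [IsProbabilityMeasure μ₂]
    (hs₁ : μ₁ (Metric.sphere (0 : EuclideanSpace ℝ (Fin d)) 1)ᶜ = 0)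
    (hs₂ : μ₂ (Metric.sphere (0 : EuclideanSpace ℝ (Fin d)) 1)ᶜ = 0)
    (h : ∀ x ∈ Metric.sphere (0 : EuclideanSpace ℝ (Fin d)) 1,
      ∫ y, Real.exp (∑ i, ∑ j, x i * B i j * y j) ∂μ₁
        = ∫ y, Real.exp (∑ i, ∑ j, x i * B i j * y j) ∂μ₂) :
    μ₁ = μ₂ := by
  have hnorm {μ : Measure (EuclideanSpace ℝ (Fin d))}
      (hs : μ (Metric.sphere (0 : EuclideanSpace ℝ (Fin d)) 1)ᶜ = 0) : ∀ᵐ y ∂μ, ‖y‖ = 1 := by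
    filter_upwards [compl_mem_ae_iff.2 hs] with y hy
    simpa using hy
  let L : EuclideanSpace ℝ (Fin d) ≃L[ℝ] EuclideanSpace ℝ (Fin d) :=
    ContinuousLinearEquiv.equivOfInverse (Matrix.toEuclideanCLM (𝕜 := ℝ) B)
      (Matrix.toEuclideanCLM (𝕜 := ℝ) B⁻¹)
      (fun x ↦ by
        rw [← mul_apply_eq_comp, ← map_mul, Matrix.nonsing_inv_mul B hBinv, map_one]
        rfl)
      (fun x ↦ by
        rw [← mul_apply_eq_comp, ← map_mul, Matrix.mul_nonsing_inv B hBinv, map_one]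
        rfl)
  have hL (x y : EuclideanSpace ℝ (Fin d)) : ⟪L x, y⟫ = ∑ i, ∑ j, x i * B i j * y j := by
    have hLx (j : Fin d) : L x j = ∑ i, B j i * x i := rfl
    simp only [PiLp.inner_apply, hLx, RCLike.inner_apply, conj_trivial, Finset.mul_sum]
    rw [Finset.sum_comm]
    refine Finset.sum_congr rfl fun i _ ↦ Finset.sum_congr rfl fun j _ ↦ ?_
    rw [hBsymm.apply]
    ring
  refine ext_of_expTransform_eqOn_image_sphere (hnorm hs₁) (hnorm hs₂) L fun x hx ↦ ?_
  simpa only [expTransform, hL] using h x hx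
end

section
/- Fix K_β(θ) = exp(β cos θ) and θ_c(β) = arccos((√(1+4β²) − 1)/(2β)). There exists β₁ > 0 such that for all β ≥ β₁, the maximum of K_β''(θ) over θ ∈ [θ_c(β), π] is at most 2 β exp(β − 3/2). -/
open Real

theorem iteratedDeriv_two_exp_mul_cos (β θ : ℝ) :
    iteratedDeriv 2 (fun t : ℝ => Real.exp (β * Real.cos t)) θ
      = (β ^ 2 * Real.sin θ ^ 2 - β * Real.cos θ) * Real.exp (β * Real.cos θ) := by
  have h_first (t : ℝ) : HasDerivAt (fun t : ℝ => Real.exp (β * Real.cos t))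
      (Real.exp (β * Real.cos t) * (β * -Real.sin t)) t :=
    ((Real.hasDerivAt_cos t).const_mul β).exp
  have h_second := (h_first θ).mul ((Real.hasDerivAt_sin θ).neg.const_mul β)
  rw [iteratedDeriv_succ, iteratedDeriv_one, funext fun t => (h_first t).deriv]
  refine h_second.deriv.trans ?_
  simp only [Pi.neg_apply]
  ring

theorem two_mul_sub_one_mul_add_le_exp {β s : ℝ} (hβ : 2 ≤ β) (hs : 0 ≤ s) :
    (2 * s - 1) * β + s - s ^ 2 ≤ 2 * β * Real.exp (s - 3 / 2) := by
  rcases le_total 1 s with h | h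
  · have h_exp := Real.add_one_le_exp (s - 3 / 2)
    nlinarith
  · have h_half := Real.add_one_le_exp ((s - 3 / 2) / 2)
    have h_sq : Real.exp (s - 3 / 2) = Real.exp ((s - 3 / 2) / 2) ^ 2 := by
      rw [← Real.exp_nat_mul]
      congr 1
      push_cast
      ring
    have h_exp : ((s - 3 / 2) / 2 + 1) ^ 2 ≤ Real.exp (s - 3 / 2) := by
      rw [h_sq]
      exact pow_le_pow_left₀ (by linarith) h_half 2
    have h_gap : s - 1 / 2 + 1 / 16 ≤ Real.exp (s - 3 / 2) := by nlinarith
    nlinarith [sq_nonneg (s - 1 / 2)]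

/-- **Bound on the second derivative of the kernel beyond the concavity radius**
(Lemma on concavity, estimate `max_{θ ∈ [θ_c, π]} K_β''(θ) ≤ 2 β e^{β - 3/2}` for `β` large). -/
theorem kernel_second_deriv_upper_bound_outside :
    ∃ β₁ > (0 : ℝ), ∀ β ≥ β₁,
      ∀ θ ∈ Set.Icc (Real.arccos ((Real.sqrt (1 + 4 * β ^ 2) - 1) / (2 * β))) Real.pi,
        iteratedDeriv 2 (fun t : ℝ => Real.exp (β * Real.cos t)) θ
          ≤ 2 * β * Real.exp (β - 3 / 2) := by
  refine ⟨2, by norm_num, fun β hβ θ _ => ?_⟩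
  rw [iteratedDeriv_two_exp_mul_cos]
  set s := β * (1 - Real.cos θ) with hs_def
  have hs : 0 ≤ s := mul_nonneg (by linarith) (sub_nonneg.2 (Real.cos_le_one θ))
  calc
    (β ^ 2 * Real.sin θ ^ 2 - β * Real.cos θ) * Real.exp (β * Real.cos θ)
        = ((2 * s - 1) * β + s - s ^ 2) * Real.exp (β * Real.cos θ) := by
      rw [Real.sin_sq, hs_def]
      ring
    _ ≤ 2 * β * Real.exp (s - 3 / 2) * Real.exp (β * Real.cos θ) := by
      gcongr
      exact two_mul_sub_one_mul_add_le_exp hβ hs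
    _ = 2 * β * Real.exp (β - 3 / 2) := by
      rw [mul_assoc, ← Real.exp_add, hs_def]
      ring_nf
end

section
/- Let d ≥ 2 and β > 0. Let ω₁, …, ω_d ∈ ℝ and a₁, …, a_d ∈ ℝ^d be perceptron weights with ReLU activation, define v(x) = Σ_{j=1}^{d} ω_j (max(⟨a_j, x⟩, 0))², and assume v is not real-analytic on S^{d-1}. If μ is a Borel probability measure on S^{d-1} satisfying the stationarity condition — for all x ∈ supp μ, (I − x xᵀ)(∫ exp(β ⟨x,y⟩) y dμ(y) + Σ_{j=1}^{d} ω_j max(⟨a_j, x⟩, 0) a_j) = 0 — then the support of μ has zero measure with respect to the rotation-invariant surface measure σ_d on S^{d-1}; in particular μ is singular with respect to σ_d. -/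
open MeasureTheory Real
open scoped RealInnerProductSpace ENNReal

/-- Orthogonal projection `(I - x xᵀ) v` onto the tangent space of the sphere at `x`. -/
noncomputable def tangentProj {d : ℕ} (x v : EuclideanSpace ℝ (Fin d)) :
    EuclideanSpace ℝ (Fin d) :=
  v - ⟪x, v⟫ • x

/-- Topological support of a measure. -/
def measSupport {α : Type*} [TopologicalSpace α] [MeasurableSpace α]
    (μ : Measure α) : Set α :=
  {x | ∀ U : Set α, IsOpen U → x ∈ U → μ U ≠ 0}

section AnalyticZeroSet

variable {E : Type*} [NormedAddCommGroup E] [NormedSpace ℝ E] [FiniteDimensional ℝ E]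
  [MeasurableSpace E] [BorelSpace E] (ν : Measure E) [ν.IsAddHaarMeasure]

theorem ae_fderiv_eq_zero_of_ae_eq_zero {g : E → ℝ} {Z : Set E} (hZ : MeasurableSet Z)
    (hd : ∀ x ∈ Z, DifferentiableAt ℝ g x) (h0 : ∀ᵐ x ∂ν.restrict Z, g x = 0) :
    ∀ᵐ x ∂ν.restrict Z, fderiv ℝ g x = 0 := by
  rcases subsingleton_or_nontrivial E with hE | hE
  · exact Filter.Eventually.of_forall fun x => Subsingleton.elim _ _
  obtain ⟨e, he⟩ := exists_ne (0 : E)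
  obtain ⟨N, hN, hNm, hN0⟩ := exists_measurable_superset_of_null (ae_iff.1 h0)
  have happ : ApproximatesLinearOn (fun x => g x • e) (0 : E →L[ℝ] E) (Z \ N) 0 := by
    intro x hx y hy
    have hgx : g x = 0 := by by_contra h; exact hx.2 (hN h)
    have hgy : g y = 0 := by by_contra h; exact hy.2 (hN h)
    simp [hgx, hgy]
  have key := happ.norm_fderiv_sub_le ν (hZ.diff hNm)
    (fun x => (fderiv ℝ g x).smulRight e) fun x hx =>
      ((hd x hx.1).hasFDerivAt.smul_const e).hasFDerivWithinAt
  rw [ae_restrict_iff' (hZ.diff hNm)] at key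
  filter_upwards [ae_restrict_of_ae key, compl_mem_ae_iff.2 hN0, ae_restrict_mem hZ]
    with x hx hxN hxZ
  have h1 := hx ⟨hxZ, hxN⟩
  simp only [sub_zero, nonpos_iff_eq_zero, nnnorm_eq_zero] at h1
  ext w
  have h2 := congrArg (fun L : E →L[ℝ] E => L w) h1
  simpa [he] using h2

/-- A real-analytic function on a connected open set that vanishes on a set of positive measure
vanishes identically. -/
theorem AnalyticOnNhd.eqOn_zero_of_measure_ne_zero {f : E → ℝ} {U Z : Set E}
    (hf : AnalyticOnNhd ℝ f U) (hU : IsPreconnected U) (hZU : Z ⊆ U)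
    (hZ : MeasurableSet Z) (hZ0 : ν Z ≠ 0) (h0 : ∀ x ∈ Z, f x = 0) : Set.EqOn f 0 U := by
  let b := Module.finBasis ℝ E
  have hder : ∀ n : ℕ, ∀ m : Fin n → Fin (Module.finrank ℝ E),
      ∀ᵐ x ∂ν.restrict Z, iteratedFDeriv ℝ n f x (fun i => b (m i)) = 0 := by
    intro n
    induction n with
    | zero =>
      intro m
      filter_upwards [ae_restrict_mem hZ] with x hx
      simpa using h0 x hx
    | succ n ih =>
      intro m
      have hdiff : ∀ x ∈ Z, DifferentiableAt ℝ (iteratedFDeriv ℝ n f) x := fun x hx =>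
        ((hf.iteratedFDeriv n) x (hZU hx)).differentiableAt
      let L := ContinuousMultilinearMap.apply ℝ (fun _ : Fin n => E) ℝ
        (fun i => b (Fin.tail m i))
      have := ae_fderiv_eq_zero_of_ae_eq_zero ν
        (g := fun x => L (iteratedFDeriv ℝ n f x)) hZ
        (fun x hx => L.differentiableAt.comp x (hdiff x hx)) (ih (Fin.tail m))
      filter_upwards [this, ae_restrict_mem hZ] with x hx hxZ
      have h1 : HasFDerivAt (fun x => L (iteratedFDeriv ℝ n f x))
          (L.comp (fderiv ℝ (iteratedFDeriv ℝ n f) x)) x :=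
        L.hasFDerivAt.comp x (hdiff x hxZ).hasFDerivAt
      rw [h1.fderiv] at hx
      rw [iteratedFDeriv_succ_apply_left]
      exact congrArg (fun A : E →L[ℝ] ℝ => A (b (m 0))) hx
  have hall : ∀ᵐ x ∂ν.restrict Z, ∀ n : ℕ, ∀ m : Fin n → Fin (Module.finrank ℝ E),
      iteratedFDeriv ℝ n f x (fun i => b (m i)) = 0 :=
    ae_all_iff.2 fun n => ae_all_iff.2 (hder n)
  have : (ae (ν.restrict Z)).NeBot := by
    rw [ae_neBot]
    simpa [Measure.restrict_eq_zero] using hZ0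
  obtain ⟨x, hx, hxZ⟩ := (hall.and (ae_restrict_mem hZ)).exists
  have hzero : ∀ n : ℕ, iteratedFDeriv ℝ n f x = 0 := by
    intro n
    apply ContinuousMultilinearMap.toMultilinearMap_injective
    exact Module.Basis.ext_multilinear (fun _ => b) fun v => by simpa using hx n v
  obtain ⟨p, r, hp⟩ := hf x (hZU hxZ)
  refine hf.eqOn_zero_of_preconnected_of_eventuallyEq_zero hU (hZU hxZ) ?_
  filter_upwards [Metric.eball_mem_nhds x hp.r_pos] with y hy
  have hy' : y - x ∈ Metric.eball (0 : E) r := by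
    simpa [edist_eq_enorm_sub] using hy
  have hs := hp.hasSum_iteratedFDeriv hy'
  simp only [hzero, add_sub_cancel] at hs
  simpa using hs.unique (by simp)

end AnalyticZeroSet

section GaussianKernel

open ComplexConjugate

variable {E : Type*} [NormedAddCommGroup E] [InnerProductSpace ℝ E] [FiniteDimensional ℝ E]
  [MeasurableSpace E]

theorem charFun_mul_conj_charFun (μ ν : Measure E) [IsFiniteMeasure μ] [IsFiniteMeasure ν]
    (ξ : E) : charFun μ ξ * conj (charFun ν ξ)
      = ∫ p, Complex.exp (⟪p.1 - p.2, ξ⟫ * Complex.I) ∂(μ.prod ν) := by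
  rw [← charFun_neg, charFun_apply, charFun_apply, ← integral_prod_mul]
  refine integral_congr_ae (Filter.Eventually.of_forall fun p => ?_)
  simp only [← Complex.exp_add, inner_sub_left, inner_neg_right]
  push_cast
  ring_nf

variable [BorelSpace E]

theorem integrable_cexp_neg_mul_sq_norm {b : ℝ} (hb : 0 < b) :
    Integrable (fun ξ : E => Complex.exp (-b * ‖ξ‖ ^ 2)) := by
  simpa using GaussianFourier.integrable_cexp_neg_mul_sq_norm_add (V := E) (b := (b : ℂ))
    (by simpa using hb) 0 0

theorem integrable_charFun_mul_conj_mul_gaussian (μ ν : Measure E) [IsFiniteMeasure μ]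
    [IsFiniteMeasure ν] {b : ℝ} (hb : 0 < b) :
    Integrable (fun ξ : E =>
      charFun μ ξ * conj (charFun ν ξ) * Complex.exp (-b * ‖ξ‖ ^ 2)) := by
  refine (integrable_cexp_neg_mul_sq_norm hb).bdd_mul (c := μ.real Set.univ * ν.real Set.univ)
    ?_ (Filter.Eventually.of_forall fun ξ => ?_)
  · exact (continuous_charFun.mul
      (Complex.continuous_conj.comp continuous_charFun)).aestronglyMeasurable
  · rw [norm_mul, RCLike.norm_conj]
    exact mul_le_mul (norm_charFun_le ξ) (norm_charFun_le ξ) (norm_nonneg _) measureReal_nonneg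

theorem integral_charFun_mul_conj_mul_gaussian (μ ν : Measure E) [IsFiniteMeasure μ]
    [IsFiniteMeasure ν] {b : ℝ} (hb : 0 < b) :
    ∫ ξ : E, charFun μ ξ * conj (charFun ν ξ) * Complex.exp (-b * ‖ξ‖ ^ 2)
      = (π / b) ^ (Module.finrank ℝ E / 2 : ℂ)
        * ∫ p, Complex.exp (-‖p.1 - p.2‖ ^ 2 / (4 * b)) ∂(μ.prod ν) := by
  have hint : Integrable (fun q : E × (E × E) => Complex.exp (⟪q.2.1 - q.2.2, q.1⟫ * Complex.I)
      * Complex.exp (-b * ‖q.1‖ ^ 2)) ((volume : Measure E).prod (μ.prod ν)) := by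
    refine (((integrable_cexp_neg_mul_sq_norm hb).comp_fst (μ.prod ν))).bdd_mul (c := 1)
      ?_ (Filter.Eventually.of_forall fun q => ?_)
    · exact Continuous.aestronglyMeasurable (by fun_prop)
    · rw [Complex.norm_exp_ofReal_mul_I]
  calc _ = ∫ ξ : E, ∫ p, Complex.exp (⟪p.1 - p.2, ξ⟫ * Complex.I)
        * Complex.exp (-b * ‖ξ‖ ^ 2) ∂(μ.prod ν) := by
        simp_rw [charFun_mul_conj_charFun, integral_mul_const]
    _ = ∫ p, (∫ ξ : E, Complex.exp (⟪p.1 - p.2, ξ⟫ * Complex.I)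
        * Complex.exp (-b * ‖ξ‖ ^ 2)) ∂(μ.prod ν) := integral_integral_swap hint
    _ = _ := by
        rw [← integral_const_mul]
        congr 1
        ext p
        have := GaussianFourier.integral_cexp_neg_mul_sq_norm_add (V := E) (b := (b : ℂ))
          (by simpa using hb) Complex.I (p.1 - p.2)
        rw [Complex.I_sq, neg_one_mul] at this
        rw [← this]
        congr 1
        ext ξ
        rw [← Complex.exp_add]
        ring_nf

theorem integral_prod_gaussian_eq_of_sphere (ρ μ : Measure E) [IsFiniteMeasure ρ]
    [IsFiniteMeasure μ] (hρ : ρ (Metric.sphere 0 1)ᶜ = 0) (hμ : μ (Metric.sphere 0 1)ᶜ = 0)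
    {β : ℝ} (hβ : 0 < β) :
    ∫ p, Complex.exp (-‖p.1 - p.2‖ ^ 2 / (4 * ((2 * β)⁻¹ : ℝ))) ∂(ρ.prod μ)
      = ((Real.exp (-β) * ∫ x, ∫ y, Real.exp (β * ⟪x, y⟫) ∂μ ∂ρ : ℝ) : ℂ) := by
  have h1 : ∀ p : E × E, Complex.exp (-‖p.1 - p.2‖ ^ 2 / (4 * ((2 * β)⁻¹ : ℝ)))
      = ((Real.exp (-‖p.1 - p.2‖ ^ 2 / (4 * (2 * β)⁻¹)) : ℝ) : ℂ) := fun p => by push_cast; rfl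
  simp_rw [h1]
  rw [integral_complex_ofReal]
  congr 1
  have hint : Integrable (fun p : E × E => Real.exp (-‖p.1 - p.2‖ ^ 2 / (4 * (2 * β)⁻¹)))
      (ρ.prod μ) := by
    refine Integrable.of_bound (Continuous.aestronglyMeasurable (by fun_prop)) 1
      (Filter.Eventually.of_forall fun p => ?_)
    rw [Real.norm_of_nonneg (Real.exp_nonneg _), Real.exp_le_one_iff]
    exact div_nonpos_of_nonpos_of_nonneg (by simp) (by positivity)
  rw [integral_prod _ hint, ← integral_const_mul]
  refine integral_congr_ae ?_
  filter_upwards [mem_ae_iff.2 hρ] with x hx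
  rw [← integral_const_mul]
  refine integral_congr_ae ?_
  filter_upwards [mem_ae_iff.2 hμ] with y hy
  rw [mem_sphere_zero_iff_norm] at hx hy
  rw [← Real.exp_add, norm_sub_sq_real, hx, hy]
  congr 1
  field_simp
  ring

theorem eq_of_integral_exp_inner_eq_on_sphere (μ ν : Measure E) [IsFiniteMeasure μ]
    [IsFiniteMeasure ν] (hμ : μ (Metric.sphere 0 1)ᶜ = 0) (hν : ν (Metric.sphere 0 1)ᶜ = 0)
    {β : ℝ} (hβ : 0 < β)
    (h : ∀ x ∈ Metric.sphere (0 : E) 1,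
      ∫ y, Real.exp (β * ⟪x, y⟫) ∂μ = ∫ y, Real.exp (β * ⟪x, y⟫) ∂ν) : μ = ν := by
  set b : ℝ := (2 * β)⁻¹ with hb_def
  have hb : 0 < b := by positivity
  set J : Measure E → Measure E → ℂ := fun ρ τ =>
    ∫ ξ : E, charFun ρ ξ * conj (charFun τ ξ) * Complex.exp (-b * ‖ξ‖ ^ 2) with hJ
  have hswap : ∀ (ρ : Measure E) [IsFiniteMeasure ρ], ρ (Metric.sphere 0 1)ᶜ = 0 →
      J ρ μ = J ρ ν := by
    intro ρ _ hρ
    simp only [hJ]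
    rw [integral_charFun_mul_conj_mul_gaussian ρ μ hb,
      integral_charFun_mul_conj_mul_gaussian ρ ν hb,
      integral_prod_gaussian_eq_of_sphere ρ μ hρ hμ hβ,
      integral_prod_gaussian_eq_of_sphere ρ ν hρ hν hβ]
    congr 3
    refine integral_congr_ae ?_
    filter_upwards [mem_ae_iff.2 hρ] with x hx using h x hx
  have hquad : ∫ ξ : E, (‖charFun μ ξ - charFun ν ξ‖ ^ 2 * Real.exp (-b * ‖ξ‖ ^ 2) : ℝ) = 0 := by
    have hexp : ∫ ξ : E, ((‖charFun μ ξ - charFun ν ξ‖ ^ 2 * Real.exp (-b * ‖ξ‖ ^ 2) : ℝ) : ℂ)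
        = J μ μ - J μ ν - (J ν μ - J ν ν) := by
      simp only [hJ]
      have i1 := integrable_charFun_mul_conj_mul_gaussian μ μ hb
      have i2 := integrable_charFun_mul_conj_mul_gaussian μ ν hb
      have i3 := integrable_charFun_mul_conj_mul_gaussian ν μ hb
      have i4 := integrable_charFun_mul_conj_mul_gaussian ν ν hb
      rw [← integral_sub i1 i2, ← integral_sub i3 i4]
      refine Eq.trans ?_ (integral_sub (i1.sub i2) (i3.sub i4))
      congr 1
      ext ξ
      push_cast
      rw [← Complex.mul_conj', map_sub]
      ring
    rw [hswap μ hμ, hswap ν hν, sub_self, sub_self, sub_self, integral_complex_ofReal] at hexp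
    exact_mod_cast hexp
  have hcont : Continuous fun ξ : E =>
      (‖charFun μ ξ - charFun ν ξ‖ ^ 2 * Real.exp (-b * ‖ξ‖ ^ 2) : ℝ) := by
    have := continuous_charFun (μ := μ)
    have := continuous_charFun (μ := ν)
    fun_prop
  have hint : Integrable fun ξ : E =>
      (‖charFun μ ξ - charFun ν ξ‖ ^ 2 * Real.exp (-b * ‖ξ‖ ^ 2) : ℝ) := by
    have hG : Integrable fun ξ : E => Real.exp (-b * ‖ξ‖ ^ 2) := by
      have := (integrable_cexp_neg_mul_sq_norm (E := E) hb).norm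
      refine this.congr (Filter.Eventually.of_forall fun ξ => ?_)
      simp only [Complex.norm_exp]
      congr 1
      norm_cast
    refine hG.bdd_mul (c := (μ.real Set.univ + ν.real Set.univ) ^ 2) ?_
      (Filter.Eventually.of_forall fun ξ => ?_)
    · exact ((continuous_charFun.sub continuous_charFun).norm.pow 2).aestronglyMeasurable
    · rw [norm_pow, norm_norm]
      gcongr
      exact (norm_sub_le _ _).trans (add_le_add (norm_charFun_le ξ) (norm_charFun_le ξ))
  rw [integral_eq_zero_iff_of_nonneg (fun ξ => by positivity) hint,
    hcont.ae_eq_iff_eq _ continuous_zero] at hquad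
  refine Measure.ext_of_charFun (funext fun ξ => ?_)
  have := congrFun hquad ξ
  simpa [Real.exp_ne_zero, sub_eq_zero] using this

end GaussianKernel

theorem integral_comap_sphere {E F : Type*} [NormedAddCommGroup E] [MeasurableSpace E]
    [BorelSpace E] [NormedAddCommGroup F] [NormedSpace ℝ F] (μ : Measure E)
    (hμ : μ (Metric.sphere 0 1)ᶜ = 0) (f : E → F) :
    ∫ y, f y ∂(μ.comap (Subtype.val : Metric.sphere (0 : E) 1 → E)) = ∫ y, f y ∂μ := by
  rw [integral_subtype_comap Metric.isClosed_sphere.measurableSet,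
    Measure.restrict_eq_self_of_ae_mem (s := Metric.sphere 0 1) (mem_ae_iff.2 hμ)]

section KernelIntegral

variable {E F : Type*} [NormedAddCommGroup E] [InnerProductSpace ℝ E] [FiniteDimensional ℝ E]
  [NormedAddCommGroup F]

/-- The continuous functions `y ↦ β ⟪x, y⟫` on the unit sphere, depending linearly on `x`. -/
noncomputable def sphereInner (β : ℝ) : E →L[ℝ] C(Metric.sphere (0 : E) 1, ℝ) :=
  LinearMap.toContinuousLinearMap
    { toFun := fun x => ⟨fun y => β * ⟪x, (y : E)⟫, by fun_prop⟩
      map_add' := fun x x' => by ext y; simp [inner_add_left, mul_add]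
      map_smul' := fun c x => by ext y; simp [inner_smul_left]; ring }

theorem sphereInner_apply (β : ℝ) (x : E) (y : Metric.sphere (0 : E) 1) :
    sphereInner β x y = β * ⟪x, (y : E)⟫ := rfl

theorem exp_sphereInner_apply (β : ℝ) (x : E) (y : Metric.sphere (0 : E) 1) :
    NormedSpace.exp (sphereInner β x) y = Real.exp (β * ⟪x, (y : E)⟫) := by
  have h := NormedSpace.map_exp (ContinuousMap.evalAlgHom ℝ ℝ y)
    (continuous_eval_const (F := C(Metric.sphere (0 : E) 1, ℝ)) y) (sphereInner β x)
  rw [← Real.exp_eq_exp_ℝ] at h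
  exact h

variable [MeasurableSpace E] [BorelSpace E]

theorem integrable_of_sphere (μ : Measure E) [IsFiniteMeasure μ]
    (hμ : μ (Metric.sphere 0 1)ᶜ = 0) {g : E → F} (hg : Continuous g) : Integrable g μ := by
  have h : μ.restrict (Metric.sphere 0 1) = μ :=
    Measure.restrict_eq_self_of_ae_mem (mem_ae_iff.2 hμ)
  rw [← h]
  exact hg.continuousOn.integrableOn_compact (isCompact_sphere 0 1)

variable [NormedSpace ℝ F]

/-- Integration of continuous functions on the unit sphere with vector weight `g`. -/
noncomputable def sphereIntegral (μ : Measure E) [IsFiniteMeasure μ] {g : E → F}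
    (hg : Continuous g) : C(Metric.sphere (0 : E) 1, ℝ) →L[ℝ] F :=
  LinearMap.mkContinuousOfExistsBound
    { toFun := fun φ => ∫ y, φ y • g y ∂(μ.comap (Subtype.val : Metric.sphere (0 : E) 1 → E))
      map_add' := fun φ ψ => by
        simp only [ContinuousMap.add_apply, add_smul]
        refine integral_add ?_ ?_ <;>
        exact Continuous.integrable_of_hasCompactSupport (by fun_prop)
          (HasCompactSupport.of_compactSpace _)
      map_smul' := fun c φ => by
        simp only [ContinuousMap.smul_apply, smul_eq_mul, mul_smul, RingHom.id_apply]
        exact integral_smul _ _ }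
    ⟨∫ y, ‖g y‖ ∂(μ.comap (Subtype.val : Metric.sphere (0 : E) 1 → E)), fun φ => by
      rw [mul_comm, ← integral_const_mul]
      refine norm_integral_le_of_norm_le ?_ (Filter.Eventually.of_forall fun y => ?_)
      · exact Continuous.integrable_of_hasCompactSupport (by fun_prop)
          (HasCompactSupport.of_compactSpace _)
      · rw [norm_smul]
        exact mul_le_mul_of_nonneg_right (φ.norm_coe_le_norm y) (norm_nonneg _)⟩

theorem sphereIntegral_apply (μ : Measure E) [IsFiniteMeasure μ] {g : E → F}
    (hg : Continuous g) (φ : C(Metric.sphere (0 : E) 1, ℝ)) : sphereIntegral μ hg φ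
      = ∫ y, φ y • g y ∂(μ.comap (Subtype.val : Metric.sphere (0 : E) 1 → E)) := rfl

theorem sphereIntegral_exp_sphereInner (μ : Measure E) [IsFiniteMeasure μ]
    (hμ : μ (Metric.sphere 0 1)ᶜ = 0) {g : E → F} (hg : Continuous g) (β : ℝ) (x : E) :
    sphereIntegral μ hg (NormedSpace.exp (sphereInner β x))
      = ∫ y, Real.exp (β * ⟪x, y⟫) • g y ∂μ := by
  rw [sphereIntegral_apply,
    ← integral_comap_sphere μ hμ fun y => Real.exp (β * ⟪x, y⟫) • g y]
  simp_rw [exp_sphereInner_apply]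

theorem analyticAt_integral_exp_inner_smul (μ : Measure E) [IsFiniteMeasure μ]
    (hμ : μ (Metric.sphere 0 1)ᶜ = 0) {g : E → F} (hg : Continuous g) (β : ℝ) (x : E) :
    AnalyticAt ℝ (fun x => ∫ y, Real.exp (β * ⟪x, y⟫) • g y ∂μ) x := by
  simp_rw [← sphereIntegral_exp_sphereInner μ hμ hg]
  have h1 : AnalyticAt ℝ (NormedSpace.exp : C(Metric.sphere (0 : E) 1, ℝ) → _)
    (sphereInner β x) := NormedSpace.exp_analytic _
  exact ((sphereIntegral μ hg).analyticAt _).comp (h1.comp ((sphereInner β).analyticAt x))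

theorem hasFDerivAt_integral_exp_inner (μ : Measure E) [IsFiniteMeasure μ]
    (hμ : μ (Metric.sphere 0 1)ᶜ = 0) (β : ℝ) (x : E) :
    HasFDerivAt (fun x => ∫ y, Real.exp (β * ⟪x, y⟫) ∂μ)
      (β • innerSL ℝ (∫ y, Real.exp (β * ⟪x, y⟫) • y ∂μ)) x := by
  have h1 : HasFDerivAt (fun x : E => sphereIntegral μ (continuous_const (y := (1 : ℝ)))
      (NormedSpace.exp (sphereInner β x))) _ x :=
    (sphereIntegral μ (continuous_const (y := (1 : ℝ)))).hasFDerivAt.comp x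
      ((hasFDerivAt_exp (𝕂 := ℝ)).comp x (sphereInner β).hasFDerivAt)
  have h2 : (fun x : E => sphereIntegral μ (continuous_const (y := (1 : ℝ)))
      (NormedSpace.exp (sphereInner β x))) = fun x => ∫ y, Real.exp (β * ⟪x, y⟫) ∂μ := by
    ext x
    rw [sphereIntegral_exp_sphereInner μ hμ]
    simp
  rw [h2] at h1
  refine h1.congr_fderiv ?_
  ext w
  have hint : Integrable (fun y : E => Real.exp (β * ⟪x, y⟫) • y) μ :=
    integrable_of_sphere μ hμ (by fun_prop)
  simp only [smul_apply, innerSL_apply_apply, smul_eq_mul,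
    ContinuousLinearMap.comp_apply, sphereIntegral_apply]
  rw [real_inner_comm, ← integral_inner hint, ← integral_const_mul, ← integral_comap_sphere μ hμ]
  congr 1
  ext y
  simp only [one_apply_eq_self, ContinuousMap.mul_apply,
    exp_sphereInner_apply, sphereInner_apply, inner_smul_right]
  ring

end KernelIntegral

section SphereGeometry

variable {E : Type*} [NormedAddCommGroup E] [InnerProductSpace ℝ E]

theorem exists_linearIsometryEquiv_map_orthogonal_pair {x x' u u' : E} (hx : ‖x‖ = ‖x'‖)
    (hu : ‖u‖ = ‖u'‖) (hxu : ⟪x, u⟫ = 0) (hxu' : ⟪x', u'⟫ = 0) :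
    ∃ R : E ≃ₗᵢ[ℝ] E, R x = x' ∧ R u = u' := by
  set R₁ : E ≃ₗᵢ[ℝ] E := Submodule.reflection (ℝ ∙ (x - x'))ᗮ
  have h1 : R₁ x = x' := Submodule.reflection_sub hx
  have h2 : ‖R₁ u‖ = ‖u'‖ := by rw [R₁.norm_map, hu]
  set R₂ : E ≃ₗᵢ[ℝ] E := Submodule.reflection (ℝ ∙ (R₁ u - u'))ᗮ
  have h3 : R₂ (R₁ u) = u' := Submodule.reflection_sub h2
  refine ⟨R₁.trans R₂, ?_, h3⟩
  rw [LinearIsometryEquiv.trans_apply, h1]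
  refine Submodule.reflection_mem_subspace_eq_self
    (Submodule.mem_orthogonal_singleton_iff_inner_left.2 ?_)
  rw [inner_sub_right, hxu', ← h1, R₁.inner_map_map, hxu, sub_zero]

variable [FiniteDimensional ℝ E]

theorem exists_unit_inner_eq_zero (hE : 2 ≤ Module.finrank ℝ E) (x : E) :
    ∃ u : E, ‖u‖ = 1 ∧ ⟪x, u⟫ = 0 := by
  have h1 := Submodule.finrank_add_finrank_orthogonal (ℝ ∙ x)
  have h2 : Module.finrank ℝ (ℝ ∙ x) ≤ 1 := (finrank_span_le_card {x}).trans (by simp)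
  have h3 : Nontrivial (ℝ ∙ x)ᗮ := Module.nontrivial_of_finrank_pos (R := ℝ) (by omega)
  obtain ⟨u, hu⟩ := exists_norm_eq (ℝ ∙ x)ᗮ zero_le_one
  exact ⟨u, hu, Submodule.mem_orthogonal_singleton_iff_inner_right.1 u.2⟩

theorem exists_eq_smul_add_norm_smul (hE : 2 ≤ Module.finrank ℝ E) {x : E} (hx : ‖x‖ = 1)
    (y : E) : ∃ u : E, ‖u‖ = 1 ∧ ⟪x, u⟫ = 0 ∧
      y = ⟪x, y⟫ • x + ‖y - ⟪x, y⟫ • x‖ • u := by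
  by_cases hw : y - ⟪x, y⟫ • x = 0
  · obtain ⟨u, hu, hxu⟩ := exists_unit_inner_eq_zero hE x
    exact ⟨u, hu, hxu, by rw [hw, norm_zero, zero_smul, add_zero]; exact sub_eq_zero.1 hw⟩
  · refine ⟨‖y - ⟪x, y⟫ • x‖⁻¹ • (y - ⟪x, y⟫ • x), norm_smul_inv_norm hw, ?_, ?_⟩
    · simp [inner_smul_right, inner_sub_right, hx]
    · rw [smul_inv_smul₀ (norm_ne_zero_iff.2 hw)]
      abel

theorem exists_cos_sin_smul (hE : 2 ≤ Module.finrank ℝ E) {x y : E} (hx : ‖x‖ = 1)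
    (hy : ‖y‖ = 1) : ∃ u : E, ‖u‖ = 1 ∧ ⟪x, u⟫ = 0 ∧
      ∃ t : ℝ, y = Real.cos t • x + Real.sin t • u := by
  obtain ⟨u, hu, hxu, h⟩ := exists_eq_smul_add_norm_smul hE hx y
  have hle := abs_le.1 ((abs_real_inner_le_norm x y).trans (by rw [hx, hy, one_mul]))
  refine ⟨u, hu, hxu, Real.arccos ⟪x, y⟫, ?_⟩
  rw [Real.cos_arccos hle.1 hle.2, Real.sin_arccos]
  have hn : ‖y - ⟪x, y⟫ • x‖ ^ 2 = 1 - ⟪x, y⟫ ^ 2 := by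
    rw [norm_sub_sq_real, hy, norm_smul, hx, inner_smul_right, real_inner_comm, mul_one,
      Real.norm_eq_abs, sq_abs]
    ring
  rw [← hn, Real.sqrt_sq (norm_nonneg _)]
  exact h

/-- A function on the unit sphere whose tangential gradient vanishes is constant. -/
theorem eq_of_tangential_gradient_eq_zero (hE : 2 ≤ Module.finrank ℝ E) {Φ : E → ℝ} {g : E → E}
    (hΦ : ∀ x : E, ‖x‖ = 1 → HasFDerivAt Φ (innerSL ℝ (g x)) x)
    (hg : ∀ x : E, ‖x‖ = 1 → ∀ w : E, ⟪x, w⟫ = 0 → ⟪g x, w⟫ = 0)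
    {x y : E} (hx : ‖x‖ = 1) (hy : ‖y‖ = 1) : Φ x = Φ y := by
  obtain ⟨u, hu, hxu, t, rfl⟩ := exists_cos_sin_smul hE hx hy
  set γ : ℝ → E := fun s => Real.cos s • x + Real.sin s • u with hγ
  have hux : ⟪u, x⟫ = 0 := by rw [real_inner_comm]; exact hxu
  have hnorm : ∀ s, ‖γ s‖ = 1 := fun s => by
    have : ‖γ s‖ ^ 2 = 1 := by
      rw [← real_inner_self_eq_norm_sq]
      simp only [hγ, inner_add_left, inner_add_right, inner_smul_left, inner_smul_right, hxu, hux,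
        real_inner_self_eq_norm_sq, hx, hu, conj_trivial]
      linear_combination Real.sin_sq_add_cos_sq s
    exact (pow_eq_one_iff_of_nonneg (norm_nonneg _) two_ne_zero).1 this
  have hderiv : ∀ s, HasDerivAt γ (-Real.sin s • x + Real.cos s • u) s := fun s =>
    ((Real.hasDerivAt_cos s).smul_const x).add ((Real.hasDerivAt_sin s).smul_const u)
  have hcomp : ∀ s, HasDerivAt (Φ ∘ γ) 0 s := fun s => by
    have h := (hΦ (γ s) (hnorm s)).comp_hasDerivAt s (hderiv s)
    rwa [innerSL_apply_apply, hg (γ s) (hnorm s)] at h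
    simp only [hγ, inner_add_left, inner_add_right, inner_smul_left, inner_smul_right, hxu, hux,
      real_inner_self_eq_norm_sq, hx, hu, conj_trivial]
    ring
  have := is_const_of_deriv_eq_zero (fun s => (hcomp s).differentiableAt)
    (fun s => (hcomp s).deriv) 0 t
  simpa [hγ] using this

end SphereGeometry

section InvariantMeasure

variable {E : Type*} [NormedAddCommGroup E] [InnerProductSpace ℝ E]
  [MeasurableSpace E] [BorelSpace E] {σ : Measure E}

theorem integral_comp_of_invariant (hσ : ∀ R : E ≃ₗᵢ[ℝ] E, σ.map R = σ) (R : E ≃ₗᵢ[ℝ] E)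
    (f : E → ℝ) : ∫ y, f (R y) ∂σ = ∫ y, f y ∂σ :=
  MeasurePreserving.integral_comp ⟨R.continuous.measurable, hσ R⟩
    R.toHomeomorph.measurableEmbedding f

theorem integral_exp_inner_mul_comp_of_invariant (hσ : ∀ R : E ≃ₗᵢ[ℝ] E, σ.map R = σ)
    (R : E ≃ₗᵢ[ℝ] E) (β : ℝ) (x : E) (f : E → ℝ) :
    ∫ y, Real.exp (β * ⟪x, y⟫) * f (R y) ∂σ = ∫ y, Real.exp (β * ⟪R x, y⟫) * f y ∂σ := by
  rw [← integral_comp_of_invariant hσ R fun y => Real.exp (β * ⟪R x, y⟫) * f y]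
  simp_rw [R.inner_map_map]

theorem exists_integral_exp_inner_eq_const (hσ : ∀ R : E ≃ₗᵢ[ℝ] E, σ.map R = σ) (β : ℝ) :
    ∃ C : ℝ, ∀ x : E, ‖x‖ = 1 → ∫ y, Real.exp (β * ⟪x, y⟫) ∂σ = C := by
  by_cases h : ∃ e : E, ‖e‖ = 1
  · obtain ⟨e, he⟩ := h
    refine ⟨∫ y, Real.exp (β * ⟪e, y⟫) ∂σ, fun x hx => ?_⟩
    obtain ⟨R, hR, -⟩ := exists_linearIsometryEquiv_map_orthogonal_pair (x := x) (x' := e)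
      (u := 0) (u' := 0) (by rw [hx, he]) rfl (inner_zero_right _) (inner_zero_right _)
    simpa [hR] using integral_exp_inner_mul_comp_of_invariant hσ R β x 1
  · push Not at h
    exact ⟨0, fun x hx => (h x hx).elim⟩

variable [FiniteDimensional ℝ E]

/-- The exponential kernel operator of an invariant measure preserves quadratic forms on the
sphere. -/
theorem exists_integral_exp_inner_mul_sq (hE : 2 ≤ Module.finrank ℝ E) [IsFiniteMeasure σ]
    (hσs : σ (Metric.sphere 0 1)ᶜ = 0) (hσ : ∀ R : E ≃ₗᵢ[ℝ] E, σ.map R = σ) (β : ℝ) :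
    ∃ A B : ℝ, ∀ x : E, ‖x‖ = 1 → ∀ a : E,
      ∫ y, Real.exp (β * ⟪x, y⟫) * ⟪a, y⟫ ^ 2 ∂σ = A * ‖a‖ ^ 2 + B * ⟪a, x⟫ ^ 2 := by
  have : Nontrivial E := Module.nontrivial_of_finrank_pos (R := ℝ) (by omega)
  obtain ⟨e, he⟩ := exists_norm_eq E zero_le_one
  obtain ⟨f, hf, hef⟩ := exists_unit_inner_eq_zero hE e
  have hint : ∀ x a b : E, Integrable (fun y => Real.exp (β * ⟪x, y⟫) * (⟪a, y⟫ * ⟪b, y⟫)) σ :=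
    fun x a b => integrable_of_sphere σ hσs (by fun_prop)
  set C₁ := ∫ y, Real.exp (β * ⟪e, y⟫) * (⟪e, y⟫ * ⟪e, y⟫) ∂σ with hC₁
  set C₂ := ∫ y, Real.exp (β * ⟪e, y⟫) * (⟪f, y⟫ * ⟪f, y⟫) ∂σ with hC₂
  refine ⟨C₂, C₁ - C₂, fun x hx a => ?_⟩
  obtain ⟨u, hu, hxu, ha⟩ := exists_eq_smul_add_norm_smul hE hx a
  set s := ⟪x, a⟫ with hs
  set r := ‖a - s • x‖ with hr
  obtain ⟨R, hRx, hRu⟩ := exists_linearIsometryEquiv_map_orthogonal_pair (x := x) (x' := e)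
    (u := u) (u' := f) (by rw [hx, he]) (by rw [hu, hf]) hxu hef
  obtain ⟨Q, hQx, hQu⟩ := exists_linearIsometryEquiv_map_orthogonal_pair (x := x) (x' := x)
    (u := u) (u' := -u) rfl (norm_neg u).symm hxu (by rw [inner_neg_right, hxu, neg_zero])
  have h1 : ∫ y, Real.exp (β * ⟪x, y⟫) * (⟪x, y⟫ * ⟪x, y⟫) ∂σ = C₁ := by
    have := integral_exp_inner_mul_comp_of_invariant hσ R β x fun y => ⟪e, y⟫ * ⟪e, y⟫
    have hl : ∀ y, ⟪e, R y⟫ = ⟪x, y⟫ := fun y => by rw [← hRx, R.inner_map_map]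
    rw [hRx, ← hC₁] at this
    simpa only [hl] using this
  have h2 : ∫ y, Real.exp (β * ⟪x, y⟫) * (⟪u, y⟫ * ⟪u, y⟫) ∂σ = C₂ := by
    have := integral_exp_inner_mul_comp_of_invariant hσ R β x fun y => ⟪f, y⟫ * ⟪f, y⟫
    rw [hRx, ← hC₂] at this
    have hl : ∀ y, ⟪f, R y⟫ = ⟪u, y⟫ := fun y => by rw [← hRu, R.inner_map_map]
    simpa only [hl] using this
  have h3 : ∫ y, Real.exp (β * ⟪x, y⟫) * (⟪x, y⟫ * ⟪u, y⟫) ∂σ = 0 := by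
    have := integral_exp_inner_mul_comp_of_invariant hσ Q β x fun y => ⟪x, y⟫ * ⟪-u, y⟫
    rw [hQx] at this
    have hl : ∀ y, ⟪x, Q y⟫ * ⟪-u, Q y⟫ = ⟪x, y⟫ * ⟪u, y⟫ := fun y => by
      rw [← hQu, Q.inner_map_map, ← Q.inner_map_map x y, hQx]
    simp_rw [hl, inner_neg_left, mul_neg, integral_neg] at this
    linarith
  have hax : ⟪a, x⟫ = s := by rw [hs, real_inner_comm]
  have hnorm : ‖a‖ ^ 2 = s ^ 2 + r ^ 2 := by
    rw [hr, norm_sub_sq_real, norm_smul, hx, inner_smul_right, hax, mul_one, Real.norm_eq_abs,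
      sq_abs]
    ring
  have hexpand : ∀ y, Real.exp (β * ⟪x, y⟫) * ⟪a, y⟫ ^ 2
      = s ^ 2 * (Real.exp (β * ⟪x, y⟫) * (⟪x, y⟫ * ⟪x, y⟫))
        + 2 * s * r * (Real.exp (β * ⟪x, y⟫) * (⟪x, y⟫ * ⟪u, y⟫))
        + r ^ 2 * (Real.exp (β * ⟪x, y⟫) * (⟪u, y⟫ * ⟪u, y⟫)) := fun y => by
    have : ⟪a, y⟫ = s * ⟪x, y⟫ + r * ⟪u, y⟫ := by
      conv_lhs => rw [ha]
      rw [inner_add_left, inner_smul_left, inner_smul_left, conj_trivial, conj_trivial]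
    rw [this]
    ring
  have hsplit := integral_add (((hint x x x).const_mul (s ^ 2)).add
    ((hint x x u).const_mul (2 * s * r))) ((hint x u u).const_mul (r ^ 2))
  simp only [Pi.add_apply] at hsplit
  simp_rw [hexpand]
  rw [hsplit, integral_add ((hint x x x).const_mul _) ((hint x x u).const_mul _),
    integral_const_mul, integral_const_mul, integral_const_mul, h1, h2, h3, hax, hnorm]
  ring

/-- Two finite rotation-invariant measures on the unit sphere are proportional. -/
theorem smul_eq_smul_of_invariant (σ τ : Measure E) [IsFiniteMeasure σ] [IsFiniteMeasure τ]
    (hσs : σ (Metric.sphere 0 1)ᶜ = 0) (hτs : τ (Metric.sphere 0 1)ᶜ = 0)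
    (hσ : ∀ R : E ≃ₗᵢ[ℝ] E, σ.map R = σ) (hτ : ∀ R : E ≃ₗᵢ[ℝ] E, τ.map R = τ) :
    τ Set.univ • σ = σ Set.univ • τ := by
  obtain ⟨c, hc⟩ := exists_integral_exp_inner_eq_const hσ 1
  obtain ⟨c', hc'⟩ := exists_integral_exp_inner_eq_const hτ 1
  have hint : Integrable (Function.uncurry fun x y : E => Real.exp (1 * ⟪x, y⟫)) (σ.prod τ) := by
    have h : (σ.prod τ).restrict (Metric.sphere 0 1 ×ˢ Metric.sphere 0 1) = σ.prod τ := by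
      rw [← Measure.prod_restrict,
        Measure.restrict_eq_self_of_ae_mem (s := Metric.sphere 0 1) (mem_ae_iff.2 hσs),
        Measure.restrict_eq_self_of_ae_mem (s := Metric.sphere 0 1) (mem_ae_iff.2 hτs)]
    rw [← h]
    refine ContinuousOn.integrableOn_compact
      ((isCompact_sphere 0 1).prod (isCompact_sphere 0 1)) (Continuous.continuousOn ?_)
    unfold Function.uncurry
    fun_prop
  have hswap := integral_integral_swap hint
  have hl : ∫ x, ∫ y, Real.exp (1 * ⟪x, y⟫) ∂τ ∂σ = σ.real Set.univ * c' := by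
    have : ∫ x, ∫ y, Real.exp (1 * ⟪x, y⟫) ∂τ ∂σ = ∫ _, c' ∂σ := by
      refine integral_congr_ae ?_
      filter_upwards [mem_ae_iff.2 hσs] with x hx using hc' x (mem_sphere_zero_iff_norm.1 hx)
    rw [this, integral_const, smul_eq_mul]
  have hr : ∫ y, ∫ x, Real.exp (1 * ⟪x, y⟫) ∂σ ∂τ = τ.real Set.univ * c := by
    have : ∫ y, ∫ x, Real.exp (1 * ⟪x, y⟫) ∂σ ∂τ = ∫ _, c ∂τ := by
      refine integral_congr_ae ?_
      filter_upwards [mem_ae_iff.2 hτs] with y hy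
      rw [← hc y (mem_sphere_zero_iff_norm.1 hy)]
      simp_rw [real_inner_comm]
    rw [this, integral_const, smul_eq_mul]
  rw [hl, hr] at hswap
  have : IsFiniteMeasure (τ Set.univ • σ) := Measure.smul_finite _ (measure_ne_top _ _)
  have : IsFiniteMeasure (σ Set.univ • τ) := Measure.smul_finite _ (measure_ne_top _ _)
  refine eq_of_integral_exp_inner_eq_on_sphere _ _ (by simp [hσs]) (by simp [hτs]) one_pos
    fun x hx => ?_
  rw [mem_sphere_zero_iff_norm] at hx
  rw [integral_smul_measure, integral_smul_measure, hc x hx, hc' x hx]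
  exact hswap.symm

end InvariantMeasure

section ConeMeasure

variable {E : Type*} [NormedAddCommGroup E] [InnerProductSpace ℝ E] [FiniteDimensional ℝ E]
  [MeasurableSpace E] [BorelSpace E]

/-- The image on the unit sphere of Lebesgue measure on the punctured unit ball under radial
projection. -/
noncomputable def coneMeasure (E : Type*) [NormedAddCommGroup E] [InnerProductSpace ℝ E]
    [FiniteDimensional ℝ E] [MeasurableSpace E] [BorelSpace E] : Measure E :=
  ((volume : Measure E).restrict (Metric.ball 0 1 \ {0})).map fun x => ‖x‖⁻¹ • x

theorem measurable_radialProjection : Measurable fun x : E => ‖x‖⁻¹ • x := by fun_prop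

theorem coneMeasure_apply {s : Set E} (hs : MeasurableSet s) :
    coneMeasure E s = volume ((fun x : E => ‖x‖⁻¹ • x) ⁻¹' s ∩ (Metric.ball 0 1 \ {0})) := by
  rw [coneMeasure, Measure.map_apply measurable_radialProjection hs,
    Measure.restrict_apply (measurable_radialProjection hs)]

instance isFiniteMeasure_coneMeasure : IsFiniteMeasure (coneMeasure E) := by
  refine ⟨?_⟩
  rw [coneMeasure_apply MeasurableSet.univ]
  exact (measure_mono (Set.inter_subset_right.trans Set.sdiff_subset)).trans_lt
    measure_ball_lt_top

theorem coneMeasure_compl_sphere : coneMeasure E (Metric.sphere 0 1)ᶜ = 0 := by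
  rw [coneMeasure_apply Metric.isClosed_sphere.measurableSet.compl]
  convert! measure_empty (μ := (volume : Measure E))
  refine Set.eq_empty_of_forall_notMem fun x hx => hx.1 ?_
  rw [mem_sphere_zero_iff_norm]
  exact norm_smul_inv_norm (𝕜 := ℝ) hx.2.2

theorem map_coneMeasure (R : E ≃ₗᵢ[ℝ] E) : (coneMeasure E).map R = coneMeasure E := by
  have hR : Measurable R := R.continuous.measurable
  have hcomm : R ∘ (fun x : E => ‖x‖⁻¹ • x) = (fun x : E => ‖x‖⁻¹ • x) ∘ R := by
    ext x
    simp
  have hpre : R ⁻¹' (Metric.ball 0 1 \ {0}) = Metric.ball 0 1 \ {0} := by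
    ext x
    simp
  have hmap : ((volume : Measure E).restrict (Metric.ball 0 1 \ {0})).map R
      = (volume : Measure E).restrict (Metric.ball 0 1 \ {0}) := by
    have := (R.measurePreserving.restrict_preimage (s := Metric.ball (0 : E) 1 \ {0})
      (measurableSet_ball.diff (measurableSet_singleton (0 : E)))).map_eq
    rwa [hpre] at this
  rw [coneMeasure, Measure.map_map hR measurable_radialProjection, hcomm,
    ← Measure.map_map measurable_radialProjection hR, hmap]

theorem coneMeasure_ne_zero_of_isOpen {U : Set E} (hU : IsOpen U) {x : E} (hx : ‖x‖ = 1)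
    (hxU : x ∈ U) : coneMeasure E U ≠ 0 := by
  rw [coneMeasure_apply hU.measurableSet]
  have hcont : ContinuousOn (fun x : E => ‖x‖⁻¹ • x) (Metric.ball 0 1 \ {0}) :=
    (continuous_norm.continuousOn.inv₀ fun y hy => norm_ne_zero_iff.2 hy.2).smul continuousOn_id
  have hopen : IsOpen ((fun x : E => ‖x‖⁻¹ • x) ⁻¹' U ∩ (Metric.ball 0 1 \ {0})) := by
    rw [Set.inter_comm]
    exact hcont.isOpen_inter_preimage (Metric.isOpen_ball.sdiff isClosed_singleton) hU
  refine hopen.measure_ne_zero _ ⟨(2⁻¹ : ℝ) • x, ?_, ?_, ?_⟩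
  · simpa [norm_smul, hx, smul_smul] using hxU
  · rw [mem_ball_zero_iff, norm_smul, hx]
    norm_num
  · have : x ≠ 0 := norm_ne_zero_iff.1 (by rw [hx]; exact one_ne_zero)
    simpa using this

variable {σ : Measure E} [IsProbabilityMeasure σ]

theorem smul_eq_coneMeasure (hσs : σ (Metric.sphere 0 1)ᶜ = 0)
    (hσ : ∀ R : E ≃ₗᵢ[ℝ] E, σ.map R = σ) : coneMeasure E Set.univ • σ = coneMeasure E := by
  rw [smul_eq_smul_of_invariant σ (coneMeasure E) hσs coneMeasure_compl_sphere hσ map_coneMeasure,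
    measure_univ, one_smul]

theorem measure_ne_zero_of_isOpen_of_invariant (hσs : σ (Metric.sphere 0 1)ᶜ = 0)
    (hσ : ∀ R : E ≃ₗᵢ[ℝ] E, σ.map R = σ) {U : Set E} (hU : IsOpen U) {x : E} (hx : ‖x‖ = 1)
    (hxU : x ∈ U) : σ U ≠ 0 := fun h => by
  apply coneMeasure_ne_zero_of_isOpen hU hx hxU
  rw [← smul_eq_coneMeasure hσs hσ, Measure.smul_apply, h, smul_zero]

/-- A function that is analytic around the unit sphere and vanishes on a subset of positive
uniform measure vanishes on the whole sphere. -/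
theorem eq_zero_on_sphere_of_measure_ne_zero (hE : 2 ≤ Module.finrank ℝ E)
    (hσs : σ (Metric.sphere 0 1)ᶜ = 0) (hσ : ∀ R : E ≃ₗᵢ[ℝ] E, σ.map R = σ) {f : E → ℝ}
    (hf : ∀ x : E, ‖x‖ = 1 → AnalyticAt ℝ f x) {Z : Set E} (hZ : MeasurableSet Z)
    (hσZ : σ Z ≠ 0) (h0 : ∀ x ∈ Z, ‖x‖ = 1 → f x = 0) {x : E} (hx : ‖x‖ = 1) : f x = 0 := by
  have hn : ∀ y : E, y ≠ 0 → ‖‖y‖⁻¹ • y‖ = 1 := fun y hy => norm_smul_inv_norm (𝕜 := ℝ) hy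
  have han : AnalyticOnNhd ℝ (fun y : E => f (‖y‖⁻¹ • y)) {0}ᶜ := fun y hy => by
    have hnorm : AnalyticAt ℝ (fun y : E => ‖y‖) y := (contDiffAt_norm ℝ hy).analyticAt
    have hproj : AnalyticAt ℝ (fun y : E => ‖y‖⁻¹ • y) y :=
      (hnorm.inv (norm_ne_zero_iff.2 hy)).smul analyticAt_id
    exact AnalyticAt.comp (f := fun y : E => ‖y‖⁻¹ • y) (hf _ (hn y hy)) hproj
  have hcone : coneMeasure E Z ≠ 0 := by
    rw [← smul_eq_coneMeasure hσs hσ, Measure.smul_apply, smul_eq_mul]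
    exact mul_ne_zero (coneMeasure_ne_zero_of_isOpen isOpen_univ hx (Set.mem_univ x)) hσZ
  rw [coneMeasure_apply hZ] at hcone
  have hrank : 1 < Module.rank ℝ E := by
    rw [← Module.finrank_eq_rank]
    exact_mod_cast hE
  have key := han.eqOn_zero_of_measure_ne_zero (volume : Measure E)
    (isConnected_compl_singleton_of_one_lt_rank hrank 0).isPreconnected
    (Set.inter_subset_right.trans fun y hy => hy.2)
    ((measurable_radialProjection hZ).inter
      (measurableSet_ball.diff (measurableSet_singleton (0 : E)))) hcone
    fun y hy => h0 _ hy.1 (hn y hy.2.2)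
  have hx0 : x ∈ ({0}ᶜ : Set E) := norm_ne_zero_iff.1 (by rw [hx]; exact one_ne_zero)
  simpa [hx] using key hx0

/-- A finite measure on the unit sphere whose exponential kernel transform agrees with that of the
signed measure `h σ` is equal to `h σ`. -/
theorem add_withDensity_eq_of_integral_exp_inner_eq (hσs : σ (Metric.sphere 0 1)ᶜ = 0)
    (μ : Measure E) [IsFiniteMeasure μ] (hμ : μ (Metric.sphere 0 1)ᶜ = 0) {β : ℝ} (hβ : 0 < β)
    {h : E → ℝ} (hh : Continuous h)
    (heq : ∀ x : E, ‖x‖ = 1 →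
      ∫ y, Real.exp (β * ⟪x, y⟫) ∂μ = ∫ y, Real.exp (β * ⟪x, y⟫) * h y ∂σ) :
    μ + σ.withDensity (fun y => ENNReal.ofReal (-h y))
      = σ.withDensity fun y => ENNReal.ofReal (h y) := by
  have hfin : ∀ {g : E → ℝ}, Continuous g →
      IsFiniteMeasure (σ.withDensity fun y => ENNReal.ofReal (g y)) := fun hg =>
    isFiniteMeasure_withDensity_ofReal (integrable_of_sphere σ hσs hg).2
  have hnull : ∀ {g : E → ℝ}, Continuous g →
      (σ.withDensity fun y => ENNReal.ofReal (g y)) (Metric.sphere 0 1)ᶜ = 0 := fun _ =>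
    withDensity_absolutelyContinuous _ _ hσs
  have hint : ∀ {g : E → ℝ}, Continuous g → ∀ x : E,
      ∫ y, Real.exp (β * ⟪x, y⟫) ∂(σ.withDensity fun y => ENNReal.ofReal (g y))
        = ∫ y, max (g y) 0 * Real.exp (β * ⟪x, y⟫) ∂σ := fun {g} hg x => by
    rw [integral_withDensity_eq_integral_toReal_smul (by fun_prop)
      (Filter.Eventually.of_forall fun y => ENNReal.ofReal_lt_top)]
    simp_rw [ENNReal.toReal_ofReal', smul_eq_mul]
  have := hfin hh
  have := hfin hh.neg
  have hneg : Continuous fun y => -h y := hh.neg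
  refine eq_of_integral_exp_inner_eq_on_sphere _ _ ?_ (hnull hh) hβ fun x hx => ?_
  · rw [Measure.add_apply, hμ, hnull hneg, add_zero]
  rw [mem_sphere_zero_iff_norm] at hx
  rw [integral_add_measure (integrable_of_sphere μ hμ (by fun_prop))
    (integrable_of_sphere _ (hnull hneg) (by fun_prop)), hint hneg, hint hh, heq x hx,
    ← integral_add (integrable_of_sphere σ hσs (by fun_prop))
      (integrable_of_sphere σ hσs (by fun_prop))]
  congr 1
  ext y
  rcases le_total 0 (h y) with hy | hy
  · rw [max_eq_left hy, max_eq_right (neg_nonpos.2 hy)]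
    ring
  · rw [max_eq_right hy, max_eq_left (neg_nonneg.2 hy)]
    ring

end ConeMeasure

section FullSupport

variable {E : Type*} [NormedAddCommGroup E] [InnerProductSpace ℝ E] [FiniteDimensional ℝ E]
  [MeasurableSpace E] [BorelSpace E] {σ : Measure E} [IsProbabilityMeasure σ]

/-- If the exponential kernel transform of `μ` is that of `h σ` with `h` analytic, and `μ` does not
charge some open set meeting the unit sphere, then `h` vanishes on the unit sphere. -/
theorem eq_zero_on_sphere_of_integral_exp_inner_eq (hE : 2 ≤ Module.finrank ℝ E)
    (hσs : σ (Metric.sphere 0 1)ᶜ = 0) (hσ : ∀ R : E ≃ₗᵢ[ℝ] E, σ.map R = σ)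
    (μ : Measure E) [IsFiniteMeasure μ] (hμ : μ (Metric.sphere 0 1)ᶜ = 0) {β : ℝ} (hβ : 0 < β)
    {h : E → ℝ} (hh : Continuous h) (han : ∀ x : E, ‖x‖ = 1 → AnalyticAt ℝ h x)
    (heq : ∀ x : E, ‖x‖ = 1 →
      ∫ y, Real.exp (β * ⟪x, y⟫) ∂μ = ∫ y, Real.exp (β * ⟪x, y⟫) * h y ∂σ)
    {U : Set E} (hU : IsOpen U) {x : E} (hx : ‖x‖ = 1) (hxU : x ∈ U) (hμU : μ U = 0)
    {y : E} (hy : ‖y‖ = 1) : h y = 0 := by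
  have hmeas := congrArg (fun m : Measure E => m.restrict U)
    (add_withDensity_eq_of_integral_exp_inner_eq hσs μ hμ hβ hh heq)
  simp only [Measure.restrict_add, Measure.restrict_eq_zero.2 hμU, zero_add,
    restrict_withDensity hU.measurableSet] at hmeas
  have hneg : Continuous fun y => -h y := hh.neg
  have hfin : ∫⁻ y, ENNReal.ofReal (-h y) ∂σ.restrict U ≠ ⊤ :=
    (((integrable_of_sphere σ hσs hneg).restrict (s := U)).lintegral_lt_top).ne
  have hae := (withDensity_eq_iff (by fun_prop) (by fun_prop) hfin).1 hmeas
  have hzero : ∀ᵐ y ∂σ.restrict U, h y = 0 := by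
    filter_upwards [hae] with y hy
    rcases le_total 0 (h y) with h0 | h0
    · rw [ENNReal.ofReal_of_nonpos (neg_nonpos.2 h0)] at hy
      exact le_antisymm (ENNReal.ofReal_eq_zero.1 hy.symm) h0
    · rw [ENNReal.ofReal_of_nonpos h0] at hy
      exact le_antisymm h0 (neg_nonpos.1 (ENNReal.ofReal_eq_zero.1 hy))
  rw [ae_restrict_iff' hU.measurableSet] at hzero
  have hZ : MeasurableSet {y | h y = 0} := (isClosed_singleton.preimage hh).measurableSet
  refine eq_zero_on_sphere_of_measure_ne_zero hE hσs hσ han hZ (fun h0 => ?_)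
    (fun y hy _ => hy) hy
  refine measure_ne_zero_of_isOpen_of_invariant hσs hσ hU hx hxU ?_
  exact measure_mono_null_ae hzero h0

/-- On the unit sphere, the exponential kernel transform of the uniform measure is a positive
constant, and that of a squared linear form is again quadratic, with nonzero leading coefficient. -/
theorem exists_integral_exp_inner_const_and_mul_sq (hE : 2 ≤ Module.finrank ℝ E)
    (hσs : σ (Metric.sphere 0 1)ᶜ = 0) (hσ : ∀ R : E ≃ₗᵢ[ℝ] E, σ.map R = σ) {β : ℝ}
    (hβ : 0 < β) :
    ∃ C A B : ℝ, 0 < C ∧ B ≠ 0 ∧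
      (∀ x : E, ‖x‖ = 1 → ∫ y, Real.exp (β * ⟪x, y⟫) ∂σ = C) ∧
      ∀ x : E, ‖x‖ = 1 → ∀ a : E,
        ∫ y, Real.exp (β * ⟪x, y⟫) * ⟪a, y⟫ ^ 2 ∂σ = A * ‖a‖ ^ 2 + B * ⟪a, x⟫ ^ 2 := by
  obtain ⟨C, hC⟩ := exists_integral_exp_inner_eq_const hσ β
  obtain ⟨A, B, hAB⟩ := exists_integral_exp_inner_mul_sq hE hσs hσ β
  have : Nontrivial E := Module.nontrivial_of_finrank_pos (R := ℝ) (by omega)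
  obtain ⟨a, ha⟩ := exists_norm_eq E zero_le_one
  have hCpos : 0 < C := by
    rw [← hC a ha]
    exact integral_exp_pos (integrable_of_sphere σ hσs (by fun_prop))
  refine ⟨C, A, B, hCpos, fun hB => ?_, hC, hAB⟩
  have hzero : ∀ y : E, ‖y‖ = 1 → C * ⟪a, y⟫ ^ 2 - A = 0 := fun y hy =>
    eq_zero_on_sphere_of_integral_exp_inner_eq hE hσs hσ (0 : Measure E) (by simp) hβ
      (h := fun y => C * ⟪a, y⟫ ^ 2 - A) (by fun_prop)
      (fun x _ => ((analyticAt_const.mul (((innerSL ℝ a).analyticAt x).pow 2)).sub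
        analyticAt_const))
      (fun x hx => by
        have h1 : ∀ y : E, Real.exp (β * ⟪x, y⟫) * (C * ⟪a, y⟫ ^ 2 - A)
            = C * (Real.exp (β * ⟪x, y⟫) * ⟪a, y⟫ ^ 2) - A * Real.exp (β * ⟪x, y⟫) :=
          fun y => by ring
        simp_rw [h1]
        rw [integral_sub (integrable_of_sphere σ hσs (by fun_prop))
          (integrable_of_sphere σ hσs (by fun_prop)), integral_const_mul, integral_const_mul,
          hAB x hx, hC x hx, hB, ha, integral_zero_measure]
        ring)
      isOpen_univ ha (Set.mem_univ a) (by simp) hy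
  obtain ⟨u, hu, hau⟩ := exists_unit_inner_eq_zero hE a
  have h1 := hzero a ha
  have h2 := hzero u hu
  rw [real_inner_self_eq_norm_sq, ha] at h1
  rw [hau] at h2
  linarith

/-- A probability measure on the unit sphere whose exponential kernel transform is quadratic on the
sphere charges every open set meeting the sphere. -/
theorem measure_ne_zero_of_integral_exp_inner_eq_quadratic (hE : 2 ≤ Module.finrank ℝ E)
    (hσs : σ (Metric.sphere 0 1)ᶜ = 0) (hσ : ∀ R : E ≃ₗᵢ[ℝ] E, σ.map R = σ)
    (μ : Measure E) [IsProbabilityMeasure μ] (hμ : μ (Metric.sphere 0 1)ᶜ = 0) {β : ℝ}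
    (hβ : 0 < β) {ι : Type*} (J : Finset ι) (α : ι → ℝ) (a : ι → E) (c : ℝ)
    (hT : ∀ x : E, ‖x‖ = 1 →
      ∫ y, Real.exp (β * ⟪x, y⟫) ∂μ = c + ∑ j ∈ J, α j * ⟪a j, x⟫ ^ 2)
    {U : Set E} (hU : IsOpen U) {x : E} (hx : ‖x‖ = 1) (hxU : x ∈ U) : μ U ≠ 0 := by
  intro hμU
  obtain ⟨C, A, B, hC, hB, hσC, hσAB⟩ := exists_integral_exp_inner_const_and_mul_sq hE hσs hσ hβ
  set c' := (c - ∑ j ∈ J, α j / B * (A * ‖a j‖ ^ 2)) / C with hc'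
  set h : E → ℝ := fun y => c' + ∑ j ∈ J, α j / B * ⟪a j, y⟫ ^ 2 with hdef
  have hh : Continuous h := by fun_prop
  have han : ∀ x : E, ‖x‖ = 1 → AnalyticAt ℝ h x := fun x _ =>
    analyticAt_const.add (Finset.analyticAt_fun_sum _ fun j _ =>
      analyticAt_const.mul (((innerSL ℝ (a j)).analyticAt x).pow 2))
  have heq : ∀ x : E, ‖x‖ = 1 →
      ∫ y, Real.exp (β * ⟪x, y⟫) ∂μ = ∫ y, Real.exp (β * ⟪x, y⟫) * h y ∂σ := fun x hx => by
    have h1 : ∀ y : E, Real.exp (β * ⟪x, y⟫) * h y = c' * Real.exp (β * ⟪x, y⟫)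
        + ∑ j ∈ J, α j / B * (Real.exp (β * ⟪x, y⟫) * ⟪a j, y⟫ ^ 2) := fun y => by
      rw [hdef, mul_add, Finset.mul_sum, mul_comm]
      congr 1
      exact Finset.sum_congr rfl fun j _ => by ring
    simp_rw [h1]
    rw [integral_add (integrable_of_sphere σ hσs (by fun_prop))
      (integrable_of_sphere σ hσs (by fun_prop)), integral_finsetSum _ fun j _ =>
        integrable_of_sphere σ hσs (by fun_prop)]
    simp_rw [integral_const_mul, hσAB x hx, hσC x hx, hT x hx, mul_add, Finset.sum_add_distrib]
    rw [hc', div_mul_cancel₀ _ hC.ne', ← add_assoc, sub_add_cancel]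
    congr 1
    exact Finset.sum_congr rfl fun j _ => by field_simp
  have hzero : ∀ y : E, ‖y‖ = 1 → h y = 0 := fun y hy =>
    eq_zero_on_sphere_of_integral_exp_inner_eq hE hσs hσ μ hμ hβ hh han heq hU hx hxU hμU hy
  have hwd : (σ.withDensity fun y => ENNReal.ofReal (h y)) = 0 := by
    rw [withDensity_eq_zero_iff (by fun_prop)]
    filter_upwards [measure_eq_zero_iff_ae_notMem.1 hσs] with y hy
    rw [hzero y (by simpa using hy), ENNReal.ofReal_zero, Pi.zero_apply]
  have hsum := add_withDensity_eq_of_integral_exp_inner_eq hσs μ hμ hβ hh heq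
  rw [hwd] at hsum
  have := congrArg (fun m : Measure E => m Set.univ) hsum
  simp at this

end FullSupport

theorem measSupport_eq_support {α : Type*} [TopologicalSpace α] [MeasurableSpace α]
    (μ : Measure α) : measSupport μ = μ.support := by
  ext x
  rw [Measure.mem_support_iff_forall]
  refine ⟨fun h U hU => ?_, fun h U hU hxU => (h U (hU.mem_nhds hxU)).ne'⟩
  obtain ⟨V, hVU, hV, hxV⟩ := mem_nhds_iff.1 hU
  exact (pos_iff_ne_zero.2 (h V hV hxV)).trans_le (measure_mono hVU)

theorem hasDerivAt_max_zero_sq (t : ℝ) :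
    HasDerivAt (fun t : ℝ => max t 0 ^ 2) (2 * max t 0) t := by
  rcases lt_trichotomy t 0 with ht | rfl | ht
  · rw [max_eq_right ht.le, mul_zero]
    refine (hasDerivAt_const t (0 : ℝ)).congr_of_eventuallyEq ?_
    filter_upwards [Iio_mem_nhds ht] with s hs
    rw [max_eq_right (le_of_lt hs), zero_pow two_ne_zero]
  · rw [max_self, mul_zero]
    refine HasDerivAt.of_isLittleO ?_
    have h : (fun t : ℝ => max t 0 ^ 2) =O[nhds 0] fun t : ℝ => t ^ 2 := by
      refine Asymptotics.IsBigO.of_norm_le fun t => ?_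
      rw [norm_pow, ← sq_abs t]
      gcongr
      rcases le_total t 0 with ht | ht
      · simp [max_eq_right ht]
      · rw [max_eq_left ht, Real.norm_eq_abs]
    simpa using h.trans_isLittleO (Asymptotics.isLittleO_pow_id one_lt_two)
  · rw [max_eq_left ht.le]
    have h := hasDerivAt_pow 2 t
    simp only [Nat.cast_ofNat, Nat.add_one_sub_one, pow_one] at h
    refine h.congr_of_eventuallyEq ?_
    filter_upwards [Ioi_mem_nhds ht] with s hs
    rw [max_eq_left (le_of_lt hs)]

section Perceptron

variable {d : ℕ}

theorem inner_eq_zero_of_tangentProj_eq_zero {x v w : EuclideanSpace ℝ (Fin d)}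
    (h : tangentProj x v = 0) (hw : ⟪x, w⟫ = 0) : ⟪v, w⟫ = 0 := by
  rw [tangentProj, sub_eq_zero] at h
  rw [h, real_inner_smul_left, hw, mul_zero]

/-- If `μ` satisfies the stationarity condition with potential `ψ` on the whole sphere, then its
exponential kernel transform is determined by `ψ` up to an additive constant. -/
theorem exists_integral_exp_inner_eq_sub (hd : 2 ≤ d) (μ : Measure (EuclideanSpace ℝ (Fin d)))
    [IsFiniteMeasure μ] (hμ : μ (Metric.sphere 0 1)ᶜ = 0) {β : ℝ}
    {ψ : EuclideanSpace ℝ (Fin d) → ℝ} {P : EuclideanSpace ℝ (Fin d) → EuclideanSpace ℝ (Fin d)}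
    (hψ : ∀ x, HasFDerivAt ψ (innerSL ℝ (P x)) x)
    (hstat : ∀ x, ‖x‖ = 1 →
      tangentProj x ((∫ y, Real.exp (β * ⟪x, y⟫) • y ∂μ) + P x) = 0) :
    ∃ c : ℝ, ∀ x, ‖x‖ = 1 → ∫ y, Real.exp (β * ⟪x, y⟫) ∂μ = c - β * ψ x := by
  have hE : 2 ≤ Module.finrank ℝ (EuclideanSpace ℝ (Fin d)) := by simpa using hd
  have hconst : ∀ x y : EuclideanSpace ℝ (Fin d), ‖x‖ = 1 → ‖y‖ = 1 →
      (∫ z, Real.exp (β * ⟪x, z⟫) ∂μ) + β * ψ x = (∫ z, Real.exp (β * ⟪y, z⟫) ∂μ) + β * ψ y :=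
    fun x y hx hy => eq_of_tangential_gradient_eq_zero hE
      (Φ := fun x => (∫ z, Real.exp (β * ⟪x, z⟫) ∂μ) + β * ψ x)
      (g := fun x => β • ((∫ y, Real.exp (β * ⟪x, y⟫) • y ∂μ) + P x))
      (fun x _ => by
        refine ((hasFDerivAt_integral_exp_inner μ hμ β x).add ((hψ x).const_mul β)).congr_fderiv ?_
        rw [map_smul, map_add, smul_add])
      (fun x hx w hw => by
        rw [real_inner_smul_left, inner_eq_zero_of_tangentProj_eq_zero (hstat x hx) hw, mul_zero])
      hx hy
  have : Nontrivial (EuclideanSpace ℝ (Fin d)) :=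
    Module.nontrivial_of_finrank_pos (R := ℝ) (by omega)
  obtain ⟨x₀, hx₀⟩ := exists_norm_eq (EuclideanSpace ℝ (Fin d)) zero_le_one
  exact ⟨_, fun x hx => eq_sub_of_add_eq (hconst x x₀ hx hx₀)⟩

theorem hasFDerivAt_half_sum_inner_sq {ι E : Type*} [NormedAddCommGroup E] [InnerProductSpace ℝ E]
    (J : Finset ι) (ω : ι → ℝ) (a : ι → E) (x : E) :
    HasFDerivAt (fun x => 2⁻¹ * ∑ j ∈ J, ω j * ⟪a j, x⟫ ^ 2)
      (innerSL ℝ (∑ j ∈ J, (ω j * ⟪a j, x⟫) • a j)) x := by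
  have h := (HasFDerivAt.fun_sum (u := J) fun j _ =>
    (((innerSL ℝ (a j)).hasFDerivAt (x := x)).pow 2).const_mul (ω j)).const_mul (2⁻¹ : ℝ)
  refine h.congr_fderiv (ContinuousLinearMap.ext fun w => ?_)
  simp [Finset.mul_sum]
  exact Finset.sum_congr rfl fun j _ => by ring

theorem hasFDerivAt_half_sum_max_inner_sq {ι E : Type*} [NormedAddCommGroup E]
    [InnerProductSpace ℝ E] (J : Finset ι) (ω : ι → ℝ) (a : ι → E) (x : E) :
    HasFDerivAt (fun x => 2⁻¹ * ∑ j ∈ J, ω j * max ⟪a j, x⟫ 0 ^ 2)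
      (innerSL ℝ (∑ j ∈ J, (ω j * max ⟪a j, x⟫ 0) • a j)) x := by
  have h := (HasFDerivAt.fun_sum (u := J) fun j _ =>
    ((hasDerivAt_max_zero_sq ⟪a j, x⟫).comp_hasFDerivAt x
      ((innerSL ℝ (a j)).hasFDerivAt (x := x))).const_mul (ω j)).const_mul (2⁻¹ : ℝ)
  refine h.congr_fderiv (ContinuousLinearMap.ext fun w => ?_)
  simp [Finset.mul_sum]
  exact Finset.sum_congr rfl fun j _ => by ring

/-- If the stationarity condition holds on the whole sphere, then the perceptron potential is
analytic around the sphere. -/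
theorem analyticAt_sum_max_inner_sq_of_stationary (hd : 2 ≤ d)
    (μ : Measure (EuclideanSpace ℝ (Fin d))) [IsFiniteMeasure μ]
    (hμ : μ (Metric.sphere 0 1)ᶜ = 0) {β : ℝ} (hβ : 0 < β) {ι : Type*} (J : Finset ι)
    (ω : ι → ℝ) (a : ι → EuclideanSpace ℝ (Fin d))
    (hstat : ∀ x, ‖x‖ = 1 → tangentProj x ((∫ y, Real.exp (β * ⟪x, y⟫) • y ∂μ)
      + ∑ j ∈ J, (ω j * max ⟪a j, x⟫ 0) • a j) = 0)
    {x : EuclideanSpace ℝ (Fin d)} (hx : x ≠ 0) :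
    AnalyticAt ℝ (fun z => ∑ j ∈ J, ω j * max ⟪a j, z⟫ 0 ^ 2) x := by
  obtain ⟨c, hc⟩ := exists_integral_exp_inner_eq_sub hd μ hμ
    (hasFDerivAt_half_sum_max_inner_sq J ω a) hstat
  have hnorm : AnalyticAt ℝ (fun y : EuclideanSpace ℝ (Fin d) => ‖y‖) x :=
    (contDiffAt_norm ℝ hx).analyticAt
  have hproj : AnalyticAt ℝ (fun y : EuclideanSpace ℝ (Fin d) => ‖y‖⁻¹ • y) x :=
    (hnorm.inv (norm_ne_zero_iff.2 hx)).smul analyticAt_id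
  have hT : AnalyticAt ℝ (fun z => ∫ y, Real.exp (β * ⟪‖z‖⁻¹ • z, y⟫) ∂μ) x := by
    have h := analyticAt_integral_exp_inner_smul μ hμ
      (continuous_const (y := (1 : ℝ))) β (‖x‖⁻¹ • x)
    simp only [smul_eq_mul, mul_one] at h
    exact AnalyticAt.comp (f := fun y : EuclideanSpace ℝ (Fin d) => ‖y‖⁻¹ • y) h hproj
  refine (((hnorm.pow 2).mul (analyticAt_const (v := 2 * β⁻¹))).mul
    ((analyticAt_const (v := c)).sub hT)).congr ?_
  filter_upwards [isOpen_ne.mem_nhds hx] with z hz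
  have hz' : ‖z‖ ≠ 0 := norm_ne_zero_iff.2 hz
  have hmax : ∀ j, max ⟪a j, ‖z‖⁻¹ • z⟫ 0 = ‖z‖⁻¹ * max ⟪a j, z⟫ 0 := fun j => by
    rw [real_inner_smul_right, mul_max_of_nonneg _ _ (inv_nonneg.2 (norm_nonneg z)), mul_zero]
  simp only [Pi.mul_apply, Pi.pow_apply, Pi.sub_apply]
  have hnz : ‖‖z‖⁻¹ • z‖ = 1 := norm_smul_inv_norm (𝕜 := ℝ) hz
  rw [hc _ hnz]
  simp_rw [hmax, mul_pow, mul_left_comm _ (‖z‖⁻¹ ^ 2), ← Finset.mul_sum]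
  field_simp
  ring

/-- The stationarity condition on a set of positive uniform measure on which the activation pattern
is constant forces full support. -/
theorem mem_measSupport_of_stationary_on (hd : 2 ≤ d)
    (μ : Measure (EuclideanSpace ℝ (Fin d))) [IsProbabilityMeasure μ]
    (hμ : μ (Metric.sphere 0 1)ᶜ = 0) {β : ℝ} (hβ : 0 < β) {ι : Type*} (J : Finset ι)
    (ω : ι → ℝ) (a : ι → EuclideanSpace ℝ (Fin d))
    {σ : Measure (EuclideanSpace ℝ (Fin d))} [IsProbabilityMeasure σ]
    (hσs : σ (Metric.sphere 0 1)ᶜ = 0)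
    (hσ : ∀ R : EuclideanSpace ℝ (Fin d) ≃ₗᵢ[ℝ] EuclideanSpace ℝ (Fin d), σ.map R = σ)
    {Z : Set (EuclideanSpace ℝ (Fin d))} (hZ : MeasurableSet Z) (hσZ : σ Z ≠ 0)
    (hstat : ∀ x ∈ Z, tangentProj x ((∫ y, Real.exp (β * ⟪x, y⟫) • y ∂μ)
      + ∑ j ∈ J, (ω j * ⟪a j, x⟫) • a j) = 0)
    {x : EuclideanSpace ℝ (Fin d)} (hx : ‖x‖ = 1) : x ∈ measSupport μ := by
  have hE : 2 ≤ Module.finrank ℝ (EuclideanSpace ℝ (Fin d)) := by simpa using hd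
  have hG : ∀ x : EuclideanSpace ℝ (Fin d), AnalyticAt ℝ (fun x =>
      (∫ y, Real.exp (β * ⟪x, y⟫) • y ∂μ) + ∑ j ∈ J, (ω j * ⟪a j, x⟫) • a j) x := fun x =>
    (analyticAt_integral_exp_inner_smul μ hμ continuous_id β x).add
      (Finset.analyticAt_fun_sum _ fun j _ =>
        (analyticAt_const.mul ((innerSL ℝ (a j)).analyticAt x)).smul analyticAt_const)
  have hinner : ∀ {f g : EuclideanSpace ℝ (Fin d) → EuclideanSpace ℝ (Fin d)}
      {x : EuclideanSpace ℝ (Fin d)}, AnalyticAt ℝ f x → AnalyticAt ℝ g x →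
      AnalyticAt ℝ (fun x => ⟪f x, g x⟫) x := fun hf hg =>
    (hf.contDiffAt.inner ℝ hg.contDiffAt).analyticAt
  have hall : ∀ x : EuclideanSpace ℝ (Fin d), ‖x‖ = 1 →
      tangentProj x ((∫ y, Real.exp (β * ⟪x, y⟫) • y ∂μ)
        + ∑ j ∈ J, (ω j * ⟪a j, x⟫) • a j) = 0 := fun x hx => by
    refine ext_inner_left ℝ fun w => ?_
    rw [inner_zero_right]
    refine eq_zero_on_sphere_of_measure_ne_zero hE hσs hσ (f := fun x =>
      ⟪w, tangentProj x ((∫ y, Real.exp (β * ⟪x, y⟫) • y ∂μ)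
        + ∑ j ∈ J, (ω j * ⟪a j, x⟫) • a j)⟫)
      (fun y _ => hinner analyticAt_const
        ((hG y).sub ((hinner analyticAt_id (hG y)).smul analyticAt_id)))
      hZ hσZ (fun y hy _ => by rw [hstat y hy, inner_zero_right]) hx
  obtain ⟨c, hc⟩ := exists_integral_exp_inner_eq_sub hd μ hμ
    (hasFDerivAt_half_sum_inner_sq J ω a) hall
  intro U hU hxU
  refine measure_ne_zero_of_integral_exp_inner_eq_quadratic hE hσs hσ μ hμ hβ J
    (fun j => -(β * 2⁻¹) * ω j) a c (fun y hy => ?_) hU hx hxU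
  rw [hc y hy]
  simp_rw [mul_assoc, ← Finset.mul_sum]
  ring

end Perceptron

/-- **Singularity of stationary measures for ReLU perceptrons in any dimension** (Theorem
`any.d` (i), ReLU case). If the ReLU perceptron potential `v(x) = Σ_j ω_j (max ⟨a_j,x⟩ 0)²`
is not real-analytic around the sphere and `μ` is a stationary probability measure on
`S^{d-1}`, then `supp μ` is null for the rotation-invariant (uniform) probability measure
`σunif` on `S^{d-1}`; in particular `μ` is singular with respect to `σunif`. -/
theorem relu_stationary_support_null
    (d : ℕ) (hd : 2 ≤ d) (β : ℝ) (hβ : 0 < β)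
    (ω : Fin d → ℝ) (a : Fin d → EuclideanSpace ℝ (Fin d))
    (hv : ¬ ∀ x ∈ Metric.sphere (0 : EuclideanSpace ℝ (Fin d)) 1,
      AnalyticAt ℝ (fun z : EuclideanSpace ℝ (Fin d) => ∑ j, ω j * max ⟪a j, z⟫ 0 ^ 2) x)
    (μ : Measure (EuclideanSpace ℝ (Fin d))) [IsProbabilityMeasure μ]
    (hs : μ (Metric.sphere (0 : EuclideanSpace ℝ (Fin d)) 1)ᶜ = 0)
    (hstat : ∀ x ∈ measSupport μ,
      tangentProj x ((∫ y, Real.exp (β * ⟪x, y⟫) • y ∂μ)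
        + ∑ j, (ω j * max ⟪a j, x⟫ 0) • a j) = 0)
    -- `σunif` is the uniform probability measure on the sphere: rotation invariant and
    -- concentrated on `S^{d-1}`.
    (σunif : Measure (EuclideanSpace ℝ (Fin d))) [IsProbabilityMeasure σunif]
    (hσs : σunif (Metric.sphere (0 : EuclideanSpace ℝ (Fin d)) 1)ᶜ = 0)
    (hσinv : ∀ R : EuclideanSpace ℝ (Fin d) ≃ₗᵢ[ℝ] EuclideanSpace ℝ (Fin d),
      Measure.map R σunif = σunif) :
    σunif (measSupport μ) = 0 ∧ μ.MutuallySingular σunif := by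
  have hclosed : IsClosed (measSupport μ) := by
    rw [measSupport_eq_support]
    exact Measure.isClosed_support
  have hcompl : μ (measSupport μ)ᶜ = 0 := by
    rw [measSupport_eq_support]
    exact Measure.measure_compl_support
  have hnull : σunif (measSupport μ) = 0 := by
    by_contra hne
    obtain ⟨J, hJ⟩ : ∃ J : Finset (Fin d),
        σunif (measSupport μ ∩ {x | ∀ j, 0 < ⟪a j, x⟫ ↔ j ∈ J}) ≠ 0 := by
      by_contra! h
      refine hne (measure_mono_null (fun x hx => ?_) (measure_iUnion_null h))
      exact Set.mem_iUnion.2 ⟨Finset.univ.filter fun j => 0 < ⟪a j, x⟫, hx, fun j => by simp⟩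
    have hpattern : MeasurableSet {x | ∀ j, 0 < ⟪a j, x⟫ ↔ j ∈ J} := by
      simp_rw [Set.ofPred_forall]
      refine MeasurableSet.iInter fun j => ?_
      have hpos : MeasurableSet {x | 0 < ⟪a j, x⟫} :=
        measurableSet_lt measurable_const (by fun_prop)
      exact hpos.iff (MeasurableSet.const _)
    have hfull : ∀ x : EuclideanSpace ℝ (Fin d), ‖x‖ = 1 → x ∈ measSupport μ := fun x hx =>
      mem_measSupport_of_stationary_on hd μ hs hβ J ω a hσs hσinv
        (hclosed.measurableSet.inter hpattern) hJ (fun y hy => by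
          convert hstat y hy.1 using 3
          rw [← Finset.sum_subset (Finset.subset_univ J) fun j _ hj => by
            rw [max_eq_right (not_lt.1 ((hy.2 j).not.2 hj)), mul_zero, zero_smul]]
          exact Finset.sum_congr rfl fun j hj => by rw [max_eq_left ((hy.2 j).2 hj).le]) hx
    refine hv fun x hx => analyticAt_sum_max_inner_sq_of_stationary hd μ hs hβ Finset.univ ω a
      (fun y hy => hstat y (hfull y hy)) ?_
    exact ne_zero_of_mem_unit_sphere ⟨x, hx⟩
  exact ⟨hnull, (measSupport μ)ᶜ, hclosed.measurableSet.compl, hcompl, by rwa [compl_compl]⟩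
end

section
/- Let d ≥ 2 and let σ(s) = max(s, 0) be the ReLU activation. Fix a Borel probability measure μ on the unit sphere S^{d-1} ⊂ ℝ^d. Then there exists a dense set U of parameters (β, (a_j, ω_j)_{j=1,…,d}) ∈ ℝ_{>0} × (ℝ^d × ℝ)^d such that whenever (β, (a_j, ω_j)_j) ∈ U and μ satisfies the stationarity condition — for all x ∈ supp μ, (I − x xᵀ)(∫ exp(β ⟨x,y⟩) y dμ(y) + Σ_{j=1}^{d} ω_j max(⟨a_j, x⟩, 0) a_j) = 0 — the restriction of μ to the active region ⋃_{j=1}^{d} {x ∈ S^{d-1} : ⟨a_j, x⟩ > 0} is purely atomic with at most countably many atoms. -/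
open MeasureTheory Real
open scoped RealInnerProductSpace ENNReal

/-- The complement of the topological support is a null set. -/
lemma measure_compl_measSupport {α : Type*} [TopologicalSpace α] [MeasurableSpace α]
    [HereditarilyLindelofSpace α] (μ : Measure α) : μ (measSupport μ)ᶜ = 0 := by
  refine measure_mono_null ?_ (Measure.measure_compl_support (μ := μ))
  refine Set.compl_subset_compl.2 fun x hx U hU hxU h0 => ?_
  exact (Measure.mem_support_iff_forall x).1 hx U (hU.mem_nhds hxU) |>.ne' h0

/-- The tangential projection commutes with adding a multiple of a vector. -/
lemma tangentProj_add_smul {d : ℕ} (x v w : EuclideanSpace ℝ (Fin d)) (c : ℝ) :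
    tangentProj x (v + c • w) = tangentProj x v + c • tangentProj x w := by
  simp only [tangentProj, inner_add_right, inner_smul_right, smul_sub, add_smul, mul_smul]
  abel

/-- A unit vector `x` with `⟪a, x⟫ > 0` at which `a` has no tangential part is `a / ‖a‖`. -/
lemma eq_normalize_of_tangentProj_eq_zero {d : ℕ} {x a : EuclideanSpace ℝ (Fin d)}
    (hx : ‖x‖ = 1) (hpos : 0 < ⟪a, x⟫) (h : tangentProj x a = 0) : ‖a‖⁻¹ • a = x := by
  rw [real_inner_comm] at hpos
  have ha : a = ⟪x, a⟫ • x := sub_eq_zero.1 h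
  have hn : ‖a‖ = ⟪x, a⟫ := by
    conv_lhs => rw [ha]
    rw [norm_smul, hx, mul_one, Real.norm_of_nonneg hpos.le]
  rw [hn, inv_smul_eq_iff₀ hpos.ne']
  exact ha

/-- **Generic atomicity on the active region for the ReLU activation** (Theorem `any.d`
(iii)). Fix a probability measure `μ` on `S^{d-1}`. There is a dense set `U` of parameters
`(β, (a_j, ω_j)_j) ∈ ℝ_{>0} × (ℝ^d × ℝ)^d` such that if the parameters lie in `U` and `μ`
is stationary for them (with `σ = ReLU`), then the restriction of `μ` to the active region
`⋃_j {x : ⟨a_j, x⟩ > 0}` is purely atomic with at most countably many atoms, i.e. it is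
concentrated on a countable set. -/
theorem generic_atomicity_relu_active_region
    (d : ℕ) (hd : 2 ≤ d)
    (μ : Measure (EuclideanSpace ℝ (Fin d))) [IsProbabilityMeasure μ]
    (hs : μ (Metric.sphere (0 : EuclideanSpace ℝ (Fin d)) 1)ᶜ = 0) :
    ∃ U : Set ({b : ℝ // 0 < b} × (Fin d → EuclideanSpace ℝ (Fin d) × ℝ)),
      Dense U ∧
      ∀ p ∈ U,
        (∀ x ∈ measSupport μ,
          tangentProj x ((∫ y, Real.exp ((p.1 : ℝ) * ⟪x, y⟫) • y ∂μ)
            + ∑ j, ((p.2 j).2 * max ⟪(p.2 j).1, x⟫ 0) • (p.2 j).1) = 0) →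
        ∃ D : Set (EuclideanSpace ℝ (Fin d)), D.Countable ∧
          μ.restrict {x : EuclideanSpace ℝ (Fin d) | ∃ j, 0 < ⟪(p.2 j).1, x⟫} Dᶜ = 0 := by
  classical
  refine ⟨{p | (∀ x ∈ measSupport μ,
      tangentProj x ((∫ y, Real.exp ((p.1 : ℝ) * ⟪x, y⟫) • y ∂μ)
        + ∑ j, ((p.2 j).2 * max ⟪(p.2 j).1, x⟫ 0) • (p.2 j).1) = 0) →
    ∃ D : Set (EuclideanSpace ℝ (Fin d)), D.Countable ∧
      μ.restrict {x : EuclideanSpace ℝ (Fin d) | ∃ j, 0 < ⟪(p.2 j).1, x⟫} Dᶜ = 0},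
    ?_, fun p hp => hp⟩
  rw [← compl_compl {p | _}, ← interior_eq_empty_iff_dense_compl]
  by_contra hne
  obtain ⟨⟨β, q⟩, hp⟩ := Set.nonempty_iff_ne_empty.2 hne
  rw [mem_interior_iff_mem_nhds] at hp
  have hself := mem_of_mem_nhds hp
  rw [Set.mem_compl_iff, Set.mem_ofPred_eq, Classical.not_imp] at hself
  obtain ⟨hstat, hbad⟩ := hself
  -- Perturbing one weight keeps stationarity, which kills the tangential part of `a_j`.
  have key : ∀ j, ∀ x ∈ measSupport μ, 0 < ⟪(q j).1, x⟫ → tangentProj x (q j).1 = 0 := by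
    intro j x hx hpos
    let γ : ℝ → {b : ℝ // 0 < b} × (Fin d → EuclideanSpace ℝ (Fin d) × ℝ) :=
      fun t => (β, Function.update q j ((q j).1, (q j).2 + t))
    have hγ : Continuous γ := by
      refine continuous_const.prodMk (continuous_const.update j ?_)
      fun_prop
    have hγ0 : γ 0 = (β, q) := by simp [γ]
    have hmem := hγ.continuousAt.preimage_mem_nhds (x := 0) (by rw [hγ0]; exact hp)
    obtain ⟨t, ht, ht0⟩ := Filter.nonempty_of_mem (Filter.inter_mem
      (mem_nhdsWithin_of_mem_nhds (t := {(0 : ℝ)}ᶜ) hmem) self_mem_nhdsWithin)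
    rw [Set.mem_preimage, Set.mem_compl_iff, Set.mem_ofPred_eq, Classical.not_imp] at ht
    have h1 := ht.1 x hx
    have h0 := hstat x hx
    have hsum : ∑ i, ((Function.update q j ((q j).1, (q j).2 + t) i).2 *
          max ⟪(Function.update q j ((q j).1, (q j).2 + t) i).1, x⟫ 0) •
            (Function.update q j ((q j).1, (q j).2 + t) i).1
        = ∑ i, ((q i).2 * max ⟪(q i).1, x⟫ 0) • (q i).1 + (t * ⟪(q j).1, x⟫) • (q j).1 := by
      rw [← sub_eq_iff_eq_add', ← Finset.sum_sub_distrib, Finset.sum_eq_single j]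
      · simp only [Function.update_self, max_eq_left hpos.le]
        rw [← sub_smul]
        ring_nf
      · intro i _ hi
        simp [Function.update_of_ne hi]
      · simp
    simp only [γ] at h1
    rw [hsum, ← add_assoc, tangentProj_add_smul, h0, zero_add] at h1
    exact (smul_eq_zero.1 h1).resolve_left (mul_ne_zero ht0 hpos.ne')
  refine hbad ⟨Set.range fun j => ‖(q j).1‖⁻¹ • (q j).1, Set.countable_range _, ?_⟩
  rw [Measure.restrict_apply (Set.finite_range _).measurableSet.compl]
  refine measure_mono_null ?_ (measure_union_null hs (measure_compl_measSupport μ))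
  rintro x ⟨hxD, j, hj⟩
  by_contra hx
  rw [Set.mem_union, not_or, Set.notMem_compl_iff, Set.notMem_compl_iff] at hx
  exact hxD ⟨j, eq_normalize_of_tangentProj_eq_zero (mem_sphere_zero_iff_norm.1 hx.1) hj
    (key j x hx.2 hj)⟩
end
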